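/- arXiv:math/0302237 — 3 statements merged into one kernel-verified Lean document; each statement's English description precedes it below -/
import Mathlib

section
/- Define Φ₁(y₁, y₂) = −(i/2) log(y₁² + y₂²) on ℝ² ∖ {(0,0)}. Then there is a unique sequence of functions (Φ_l)_{l ≥ 1} on ℝ² ∖ {(0,0)} such that for every l ≥ 1: Φ_{l+1} has the form Φ_{l+1}(y₁,y₂) = p₁(y₁,y₂) log(y₁² + y₂²) + p₂(y₁,y₂), where p₁ and p₂ are homogeneous polynomials of degree 2l in (y₁, y₂) with p₂(y₁, 0) = 0 for all y₁, and Φ_{l+1} satisfies ∂Φ_{l+1}/∂y₂ = (1/(2l)) y₂ Φ_l on ℝ² ∖ {(0,0)}. In particular, for every l ≥ 1, Φ_l = p log(y₁² + y₂²) + q with p, q homogeneous polynomials of degree 2l − 2. -/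
/- STATEMENT 8: existence and uniqueness of the model singular functions Φ_l:
Φ₁ = −(i/2) log(y₁²+y₂²), and Φ_{l+1} is the unique function of the form
p₁ log(y₁²+y₂²) + p₂ with p₁, p₂ homogeneous of degree 2l and p₂(y₁,0) = 0 solving
∂Φ_{l+1}/∂y₂ = (1/(2l)) y₂ Φ_l on ℝ² ∖ {0}.  In particular each Φ_l has the form
p log(y₁²+y₂²) + q with p, q homogeneous of degree 2l−2. -/

noncomputable section

/-- The defining property of the family `(Φ_l)_{l ≥ 1}` of model singular functions. -/
def PhiFamily (Φ : ℕ → (ℝ × ℝ → ℂ)) : Prop :=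
  (∀ y : ℝ × ℝ, y ≠ 0 →
      Φ 1 y = -(Complex.I / 2) * ((Real.log (y.1 ^ 2 + y.2 ^ 2) : ℝ) : ℂ)) ∧
  (∀ l : ℕ, 1 ≤ l →
    ∃ p₁ p₂ : MvPolynomial (Fin 2) ℂ,
      p₁.IsHomogeneous (2 * l) ∧ p₂.IsHomogeneous (2 * l) ∧
      (∀ y₁ : ℝ, MvPolynomial.eval ![(y₁ : ℂ), (0 : ℂ)] p₂ = 0) ∧
      (∀ y : ℝ × ℝ, y ≠ 0 →
        Φ (l + 1) y = MvPolynomial.eval ![(y.1 : ℂ), (y.2 : ℂ)] p₁ *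
              ((Real.log (y.1 ^ 2 + y.2 ^ 2) : ℝ) : ℂ)
            + MvPolynomial.eval ![(y.1 : ℂ), (y.2 : ℂ)] p₂) ∧
      (∀ y : ℝ × ℝ, y ≠ 0 →
        fderiv ℝ (Φ (l + 1)) y ((0 : ℝ), (1 : ℝ)) =
          (1 / (2 * (l : ℂ))) * (y.2 : ℂ) * Φ l y))

namespace ModelSingular

open MvPolynomial

/-- The antiderivative of a polynomial in the second variable vanishing on `{y₂ = 0}`. -/
def antideriv (p : MvPolynomial (Fin 2) ℂ) : MvPolynomial (Fin 2) ℂ :=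
  ∑ d ∈ p.support, monomial (d + Finsupp.single 1 1) (coeff d p / ((d 1 : ℂ) + 1))

theorem pderiv_antideriv (p : MvPolynomial (Fin 2) ℂ) : pderiv 1 (antideriv p) = p := by
  conv_rhs => rw [p.as_sum]
  rw [antideriv, map_sum]
  refine Finset.sum_congr rfl fun d _ => ?_
  have h : ((d 1 : ℂ) + 1) ≠ 0 := Nat.cast_add_one_ne_zero _
  rw [pderiv_monomial]
  simp [div_mul_cancel₀ _ h]

theorem antideriv_isHomogeneous {p : MvPolynomial (Fin 2) ℂ} {n : ℕ} (hp : p.IsHomogeneous n) :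
    (antideriv p).IsHomogeneous (n + 1) := by
  refine IsHomogeneous.sum _ _ (n + 1) fun d hd => isHomogeneous_monomial _ ?_
  have h := hp (mem_support_iff.mp hd)
  rw [Pi.one_def, ← Finsupp.degree_eq_weight_one] at h
  simpa using h

theorem eval_antideriv_axis (p : MvPolynomial (Fin 2) ℂ) (a : ℂ) :
    eval ![a, 0] (antideriv p) = 0 := by
  rw [antideriv, map_sum]
  refine Finset.sum_eq_zero fun d _ => ?_
  rw [eval_monomial, Finsupp.prod_fintype _ _ (by simp)]
  simp [Fin.prod_univ_two]

theorem hasDerivAt_eval (p : MvPolynomial (Fin 2) ℂ) (a z : ℂ) :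
    HasDerivAt (fun z => eval ![a, z] p) (eval ![a, z] (pderiv 1 p)) z := by
  induction p using MvPolynomial.induction_on with
  | C c => simpa using hasDerivAt_const z c
  | add p q hp hq => simp only [map_add]; exact hp.fun_add hq
  | mul_X p i hp =>
    have hX : HasDerivAt (fun z => eval ![a, z] (X i)) (eval ![a, z] (pderiv 1 (X i))) z := by
      fin_cases i
      · simpa [pderiv_X] using hasDerivAt_const z a
      · simpa using hasDerivAt_id' z
    simp only [map_mul, Derivation.leibniz, smul_eq_mul, map_add]
    exact (hp.fun_mul hX).congr_deriv (by ring)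

theorem eval_eq_of_pderiv_eq_zero {p : MvPolynomial (Fin 2) ℂ} (hp : pderiv 1 p = 0)
    (a b c : ℂ) : eval ![a, b] p = eval ![a, c] p :=
  is_const_of_deriv_eq_zero (fun z => (hasDerivAt_eval p a z).differentiableAt)
    (fun z => by rw [(hasDerivAt_eval p a z).deriv, hp, map_zero]) b c

theorem exists_hasFDerivAt_eval (p : MvPolynomial (Fin 2) ℂ) (y : ℝ × ℝ) :
    ∃ L : ℝ × ℝ →L[ℝ] ℂ,
      HasFDerivAt (fun y : ℝ × ℝ => eval ![(y.1 : ℂ), (y.2 : ℂ)] p) L y ∧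
      L (0, 1) = eval ![(y.1 : ℂ), (y.2 : ℂ)] (pderiv 1 p) := by
  induction p using MvPolynomial.induction_on with
  | C c => exact ⟨0, by simpa using hasFDerivAt_const c y, by simp⟩
  | add p q hp hq =>
    obtain ⟨L, hL, hL'⟩ := hp
    obtain ⟨M, hM, hM'⟩ := hq
    exact ⟨L + M, by simpa only [map_add] using hL.fun_add hM, by simp [hL', hM']⟩
  | mul_X p i hp =>
    obtain ⟨L, hL, hL'⟩ := hp
    obtain ⟨M, hM, hM'⟩ : ∃ M : ℝ × ℝ →L[ℝ] ℂ,
        HasFDerivAt (fun y : ℝ × ℝ => eval ![(y.1 : ℂ), (y.2 : ℂ)] (X i)) M y ∧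
        M (0, 1) = eval ![(y.1 : ℂ), (y.2 : ℂ)] (pderiv 1 (X i)) := by
      fin_cases i
      · refine ⟨Complex.ofRealCLM.comp (ContinuousLinearMap.fst ℝ ℝ ℝ), ?_, ?_⟩
        · exact (Complex.ofRealCLM.comp (ContinuousLinearMap.fst ℝ ℝ ℝ)).hasFDerivAt.congr_of_eventuallyEq
            (.of_forall fun y => by simp)
        · simp [pderiv_X]
      · refine ⟨Complex.ofRealCLM.comp (ContinuousLinearMap.snd ℝ ℝ ℝ), ?_, ?_⟩
        · exact (Complex.ofRealCLM.comp (ContinuousLinearMap.snd ℝ ℝ ℝ)).hasFDerivAt.congr_of_eventuallyEq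
            (.of_forall fun y => by simp)
        · simp
    refine ⟨_, by simpa only [map_mul] using hL.fun_mul hM, ?_⟩
    simp [hL', hM']

theorem sq_add_sq_pos {y : ℝ × ℝ} (hy : y ≠ 0) : 0 < y.1 ^ 2 + y.2 ^ 2 := by
  by_contra! h
  refine hy (Prod.ext ?_ ?_)
  · exact pow_eq_zero_iff two_ne_zero |>.mp (by nlinarith [sq_nonneg y.1, sq_nonneg y.2])
  · exact pow_eq_zero_iff two_ne_zero |>.mp (by nlinarith [sq_nonneg y.1, sq_nonneg y.2])

/-- The function `p log(y₁² + y₂²) + q`. -/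
def logForm (p q : MvPolynomial (Fin 2) ℂ) (y : ℝ × ℝ) : ℂ :=
  eval ![(y.1 : ℂ), (y.2 : ℂ)] p * ((Real.log (y.1 ^ 2 + y.2 ^ 2) : ℝ) : ℂ) +
    eval ![(y.1 : ℂ), (y.2 : ℂ)] q

theorem fderiv_logForm (p q : MvPolynomial (Fin 2) ℂ) {y : ℝ × ℝ} (hy : y ≠ 0) :
    fderiv ℝ (logForm p q) y (0, 1) = logForm (pderiv 1 p) (pderiv 1 q) y +
      eval ![(y.1 : ℂ), (y.2 : ℂ)] p * (2 * y.2 / ((y.1 : ℂ) ^ 2 + (y.2 : ℂ) ^ 2)) := by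
  obtain ⟨L, hL, hL'⟩ := exists_hasFDerivAt_eval p y
  obtain ⟨M, hM, hM'⟩ := exists_hasFDerivAt_eval q y
  have h1 : HasFDerivAt (fun y : ℝ × ℝ => y.1) (ContinuousLinearMap.fst ℝ ℝ ℝ) y := hasFDerivAt_fst
  have h2 : HasFDerivAt (fun y : ℝ × ℝ => y.2) (ContinuousLinearMap.snd ℝ ℝ ℝ) y := hasFDerivAt_snd
  have hlog := Complex.ofRealCLM.hasFDerivAt.comp y
    (((h1.pow 2).add (h2.pow 2)).log (sq_add_sq_pos hy).ne')
  have h := (hL.mul hlog).add hM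
  have h' : fderiv ℝ (logForm p q) y = _ := h.fderiv
  rw [h']
  simp [hL', hM', logForm]
  ring

theorem eq_zero_of_eval_eq_zero {p : MvPolynomial (Fin 2) ℂ}
    (h : ∀ y : ℝ × ℝ, y ≠ 0 → eval ![(y.1 : ℂ), (y.2 : ℂ)] p = 0) : p = 0 := by
  have hinf : (((↑) : ℝ → ℂ) '' Set.Ioi 0).Infinite :=
    (Set.Ioi_infinite (0 : ℝ)).image Complex.ofReal_injective.injOn
  refine MvPolynomial.funext_set (fun _ => ((↑) : ℝ → ℂ) '' Set.Ioi 0) (fun _ => hinf) ?_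
  intro x hx
  obtain ⟨a, ha, hax⟩ := hx 0 trivial
  obtain ⟨b, -, hbx⟩ := hx 1 trivial
  have hx' : x = ![(a : ℂ), (b : ℂ)] := by
    ext i
    fin_cases i
    · exact hax.symm
    · exact hbx.symm
  rw [hx', map_zero]
  exact h (a, b) fun hab => (ne_of_gt ha) (congrArg Prod.fst hab)

theorem eval_double {p : MvPolynomial (Fin 2) ℂ} {n : ℕ} (hp : p.IsHomogeneous n) (a b : ℂ) :
    eval ![2 * a, 2 * b] p = 2 ^ n * eval ![a, b] p := by
  rw [eval_eq', eval_eq', Finset.mul_sum]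
  refine Finset.sum_congr rfl fun d hd => ?_
  have h := hp (mem_support_iff.mp hd)
  rw [Pi.one_def, ← Finsupp.degree_eq_weight_one, Finsupp.degree_eq_sum, Fin.sum_univ_two] at h
  simp only [Fin.prod_univ_two, Matrix.cons_val_zero, Matrix.cons_val_one, ← h]
  ring

/-- A homogeneous logarithmic form vanishes only trivially. -/
theorem eq_zero_of_logForm_eq_zero {p q : MvPolynomial (Fin 2) ℂ} {n : ℕ}
    (hp : p.IsHomogeneous n) (hq : q.IsHomogeneous n)
    (h : ∀ y : ℝ × ℝ, y ≠ 0 → logForm p q y = 0) : p = 0 ∧ q = 0 := by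
  have hp0 : p = 0 := by
    refine eq_zero_of_eval_eq_zero fun y hy => ?_
    have h1 := h y hy
    have h2 := h ((2 : ℝ) • y) (smul_ne_zero two_ne_zero hy)
    have hlog : Real.log ((2 * y.1) ^ 2 + (2 * y.2) ^ 2) =
        Real.log 4 + Real.log (y.1 ^ 2 + y.2 ^ 2) := by
      rw [← Real.log_mul (by norm_num) (sq_add_sq_pos hy).ne']
      ring_nf
    simp only [logForm, Prod.smul_fst, Prod.smul_snd, smul_eq_mul, hlog, Complex.ofReal_mul,
      Complex.ofReal_ofNat, eval_double hp, eval_double hq, Complex.ofReal_add] at h1 h2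
    have h4 : ((Real.log 4 : ℝ) : ℂ) ≠ 0 :=
      Complex.ofReal_ne_zero.mpr (Real.log_pos (by norm_num)).ne'
    have h3 : (2 : ℂ) ^ n * (((Real.log 4 : ℝ) : ℂ) * eval ![(y.1 : ℂ), (y.2 : ℂ)] p) = 0 := by
      linear_combination h2 - 2 ^ n * h1
    simpa only [mul_eq_zero, pow_eq_zero_iff', OfNat.ofNat_ne_zero, false_and, false_or, h4] using h3
  refine ⟨hp0, eq_zero_of_eval_eq_zero fun y hy => ?_⟩
  simpa [logForm, hp0] using h y hy

/-- The polynomial `y₁² + y₂²`. -/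
def normSq : MvPolynomial (Fin 2) ℂ := X 0 ^ 2 + X 1 ^ 2

theorem normSq_isHomogeneous : normSq.IsHomogeneous 2 :=
  (isHomogeneous_X_pow 0 2).add (isHomogeneous_X_pow 1 2)

theorem normSq_ne_zero : normSq ≠ 0 := by
  intro h
  have := congrArg (eval ![1, 0]) h
  simp [normSq] at this

theorem eq_zero_of_fderiv_logForm_eq_zero {p q : MvPolynomial (Fin 2) ℂ} {n : ℕ}
    (hp : p.IsHomogeneous (n + 1)) (hq : q.IsHomogeneous (n + 1))
    (hq0 : ∀ a : ℝ, eval ![(a : ℂ), 0] q = 0)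
    (h : ∀ y : ℝ × ℝ, y ≠ 0 → fderiv ℝ (logForm p q) y (0, 1) = 0) : p = 0 ∧ q = 0 := by
  have hA : (normSq * pderiv 1 p).IsHomogeneous (n + 2) := by
    simpa [add_comm] using normSq_isHomogeneous.mul (hp.pderiv (i := 1))
  have hB : (C 2 * X 1 * p + normSq * pderiv 1 q).IsHomogeneous (n + 2) := by
    refine IsHomogeneous.add ?_ ?_
    · have := ((isHomogeneous_C (Fin 2) (2 : ℂ)).mul (isHomogeneous_X ℂ (1 : Fin 2))).mul hp
      rwa [show 0 + 1 + (n + 1) = n + 2 by ring] at this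
    · simpa [add_comm] using normSq_isHomogeneous.mul (hq.pderiv (i := 1))
  obtain ⟨h1, h2⟩ := eq_zero_of_logForm_eq_zero hA hB fun y hy => by
    have hs : ((y.1 : ℂ) ^ 2 + (y.2 : ℂ) ^ 2) ≠ 0 := by
      exact_mod_cast (sq_add_sq_pos hy).ne'
    have h0 := h y hy
    rw [fderiv_logForm p q hy] at h0
    simp only [logForm] at h0 ⊢
    simp only [normSq, map_add, map_mul, map_pow, eval_X, eval_C, Matrix.cons_val_zero,
      Matrix.cons_val_one]
    field_simp at h0
    linear_combination h0
  have hdp : pderiv 1 p = 0 := (mul_eq_zero.mp h1).resolve_left normSq_ne_zero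
  have hp0 : p = 0 := by
    have hX : ∀ a b : ℝ, a ≠ 0 → eval ![(a : ℂ), (b : ℂ)] p = 0 := fun a b ha => by
      have h3 := congrArg (eval ![(a : ℂ), Complex.I * a]) h2
      rw [eval_eq_of_pderiv_eq_zero hdp (a : ℂ) b (Complex.I * a)]
      simpa [normSq, mul_pow, ha] using h3
    have : X 0 * p = 0 := eq_zero_of_eval_eq_zero fun y _ => by
      by_cases hy : y.1 = 0
      · simp [hy]
      · simp [hX y.1 y.2 hy]
    exact (mul_eq_zero.mp this).resolve_left (X_ne_zero 0)
  subst hp0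
  have hdq : pderiv 1 q = 0 :=
    (mul_eq_zero.mp (by simpa using h2)).resolve_left normSq_ne_zero
  exact ⟨rfl, eq_zero_of_eval_eq_zero fun y _ => by
    rw [eval_eq_of_pderiv_eq_zero hdq _ _ 0, hq0]⟩

theorem logForm_sub (p q p' q' : MvPolynomial (Fin 2) ℂ) (y : ℝ × ℝ) :
    logForm (p - p') (q - q') y = logForm p q y - logForm p' q' y := by
  simp only [logForm, map_sub]
  ring

theorem fderiv_logForm_sub (p q p' q' : MvPolynomial (Fin 2) ℂ) {y : ℝ × ℝ} (hy : y ≠ 0) :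
    fderiv ℝ (logForm (p - p') (q - q')) y (0, 1) =
      fderiv ℝ (logForm p q) y (0, 1) - fderiv ℝ (logForm p' q') y (0, 1) := by
  simp only [fderiv_logForm _ _ hy, map_sub, logForm_sub]
  ring

theorem fderiv_congr_of_ne_zero {f g : ℝ × ℝ → ℂ} (h : ∀ y, y ≠ 0 → f y = g y) {y : ℝ × ℝ}
    (hy : y ≠ 0) : fderiv ℝ f y = fderiv ℝ g y :=
  Filter.EventuallyEq.fderiv_eq ((isOpen_ne.eventually_mem hy).mono h)

theorem eq_of_phiFamily {Φ Ψ : ℕ → (ℝ × ℝ → ℂ)} (hΦ : PhiFamily Φ) (hΨ : PhiFamily Ψ) {l : ℕ}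
    (hl : 1 ≤ l) : ∀ y : ℝ × ℝ, y ≠ 0 → Ψ l y = Φ l y := by
  induction l, hl using Nat.le_induction with
  | base => exact fun y hy => (hΨ.1 y hy).trans (hΦ.1 y hy).symm
  | succ l hl ih =>
    obtain ⟨p, q, hp, hq, hq0, hform, hder⟩ := hΨ.2 l hl
    obtain ⟨p', q', hp', hq', hq0', hform', hder'⟩ := hΦ.2 l hl
    change ∀ y : ℝ × ℝ, y ≠ 0 → Ψ (l + 1) y = logForm p q y at hform
    change ∀ y : ℝ × ℝ, y ≠ 0 → Φ (l + 1) y = logForm p' q' y at hform'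
    have hn : 2 * l = 2 * l - 1 + 1 := by omega
    rw [hn] at hp hq hp' hq'
    obtain ⟨h1, h2⟩ := eq_zero_of_fderiv_logForm_eq_zero (hp.sub hp') (hq.sub hq')
      (fun a => by rw [map_sub, hq0, hq0', sub_zero]) fun y hy => by
        rw [fderiv_logForm_sub _ _ _ _ hy, ← fderiv_congr_of_ne_zero hform hy,
          ← fderiv_congr_of_ne_zero hform' hy, hder y hy, hder' y hy, ih y hy, sub_self]
    intro y hy
    rw [hform y hy, hform' y hy, sub_eq_zero.mp h1, sub_eq_zero.mp h2]

/-- The coefficient of `(y₁² + y₂²)ᵏ log(y₁² + y₂²)` in `Φ_{k+1}`. -/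
def logCoeff : ℕ → ℂ
  | 0 => -(Complex.I / 2)
  | k + 1 => logCoeff k / (4 * ((k : ℂ) + 1) ^ 2)

/-- The polynomial multiplying the logarithm in `Φ_{k+1}`. -/
def logPart (k : ℕ) : MvPolynomial (Fin 2) ℂ := C (logCoeff k) * normSq ^ k

/-- The polynomial part of `Φ_{k+1}`. -/
def polyPart : ℕ → MvPolynomial (Fin 2) ℂ
  | 0 => 0
  | k + 1 => antideriv (X 1 *
      (C (1 / (2 * ((k : ℂ) + 1))) * polyPart k - C (2 * logCoeff (k + 1)) * normSq ^ k))

theorem normSq_pow_isHomogeneous (c : ℂ) (k : ℕ) : (C c * normSq ^ k).IsHomogeneous (2 * k) := by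
  simpa using (isHomogeneous_C (Fin 2) c).mul (normSq_isHomogeneous.pow k)

theorem polyPart_isHomogeneous (k : ℕ) : (polyPart k).IsHomogeneous (2 * k) := by
  induction k with
  | zero => exact isHomogeneous_zero _ _ _
  | succ k ih =>
    have h := (isHomogeneous_C (Fin 2) (1 / (2 * ((k : ℂ) + 1)))).mul ih
    rw [zero_add] at h
    have h' := antideriv_isHomogeneous ((isHomogeneous_X ℂ (1 : Fin 2)).mul
      (h.sub (normSq_pow_isHomogeneous (2 * logCoeff (k + 1)) k)))
    rwa [show 1 + 2 * k + 1 = 2 * (k + 1) by ring] at h'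

theorem eval_polyPart_axis (k : ℕ) (a : ℂ) : eval ![a, 0] (polyPart k) = 0 := by
  cases k with
  | zero => simp [polyPart]
  | succ k => exact eval_antideriv_axis _ a

theorem fderiv_logForm_succ (k : ℕ) {y : ℝ × ℝ} (hy : y ≠ 0) :
    fderiv ℝ (logForm (logPart (k + 1)) (polyPart (k + 1))) y (0, 1) =
      (1 / (2 * ((k : ℂ) + 1))) * (y.2 : ℂ) * logForm (logPart k) (polyPart k) y := by
  have hs : ((y.1 : ℂ) ^ 2 + (y.2 : ℂ) ^ 2) ≠ 0 := by exact_mod_cast (sq_add_sq_pos hy).ne'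
  have hk : ((k : ℂ) + 1) ≠ 0 := Nat.cast_add_one_ne_zero k
  have hp : pderiv 1 (logPart (k + 1)) =
      C (logCoeff (k + 1) * (2 * ((k : ℂ) + 1))) * normSq ^ k * X 1 := by
    have h0 : pderiv 1 normSq = C 2 * X 1 := by
      simp only [map_ofNat]
      simp [normSq, pderiv_X, Derivation.leibniz_pow, two_mul]
    rw [logPart, pderiv_C_mul, Derivation.leibniz_pow, h0]
    simp
    ring
  rw [fderiv_logForm _ _ hy, hp, polyPart, pderiv_antideriv]
  simp only [logForm, logPart, normSq, map_add, map_mul, map_sub, map_pow, eval_X, eval_C,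
    Matrix.cons_val_zero, Matrix.cons_val_one, logCoeff]
  field_simp
  ring

end ModelSingular

open ModelSingular in
theorem model_singular_functions_exist_unique :
    ∃ Φ : ℕ → (ℝ × ℝ → ℂ), PhiFamily Φ ∧
      (∀ Ψ : ℕ → (ℝ × ℝ → ℂ), PhiFamily Ψ →
        ∀ l : ℕ, 1 ≤ l → ∀ y : ℝ × ℝ, y ≠ 0 → Ψ l y = Φ l y) ∧
      (∀ l : ℕ, 1 ≤ l →
        ∃ p q : MvPolynomial (Fin 2) ℂ,
          p.IsHomogeneous (2 * l - 2) ∧ q.IsHomogeneous (2 * l - 2) ∧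
          ∀ y : ℝ × ℝ, y ≠ 0 →
            Φ l y = MvPolynomial.eval ![(y.1 : ℂ), (y.2 : ℂ)] p *
                  ((Real.log (y.1 ^ 2 + y.2 ^ 2) : ℝ) : ℂ)
                + MvPolynomial.eval ![(y.1 : ℂ), (y.2 : ℂ)] q) := by
  have hfam : PhiFamily fun l => logForm (logPart (l - 1)) (polyPart (l - 1)) := by
    refine ⟨fun y _ => by simp [logForm, logPart, polyPart, logCoeff], fun l hl => ?_⟩
    obtain ⟨k, rfl⟩ := Nat.exists_eq_add_of_le' hl
    refine ⟨logPart (k + 1), polyPart (k + 1), normSq_pow_isHomogeneous _ _,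
      polyPart_isHomogeneous _, fun a => eval_polyPart_axis _ a, fun y _ => rfl, fun y hy => ?_⟩
    simpa using fderiv_logForm_succ k hy
  refine ⟨_, hfam, fun Ψ hΨ l hl => eq_of_phiFamily hfam hΨ hl, fun l _ => ?_⟩
  rw [show 2 * l - 2 = 2 * (l - 1) by omega]
  exact ⟨logPart (l - 1), polyPart (l - 1), normSq_pow_isHomogeneous _ _,
    polyPart_isHomogeneous _, fun y _ => rfl⟩
end
end

section
/- Let (Φ_l)_{l ≥ 1} be the functions defined by Φ₁ = −(i/2) log(y₁² + y₂²) and ∂Φ_{l+1}/∂y₂ = (1/(2l)) y₂ Φ_l within the class p₁ log(y₁² + y₂²) + p₂ with p₁, p₂ homogeneous of degree 2l and p₂(y₁,0) = 0. Fix l ≥ 1 and set (Φ_l)_0 = Φ_l restricted to the upper half-plane {y₂ > 0}. Then for every j ≥ 1 there exists a unique function (Φ_l)_j on {(y₁, y₂) : y₂ > 0} of the form (Φ_l)_j = p₁ log(y₁² + y₂²) + p₂ + p₃ arctan(y₁/y₂), where p₁, p₂, p₃ are homogeneous polynomials of degree 2l − 2 + j in (y₁, y₂) with p₂(0, y₂)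 = 0 for all y₂, satisfying ∂(Φ_l)_j/∂y₁ = (Φ_l)_{j−1} on {y₂ > 0}. -/
/- STATEMENT 9: given Φ_l (of the form p log(y₁²+y₂²) + q with p, q homogeneous of degree
2l−2), there is a unique chain ((Φ_l)_j)_{j≥0} on the upper half-plane with (Φ_l)_0 = Φ_l,
each (Φ_l)_j (j ≥ 1) of the form p₁ log(y₁²+y₂²) + p₂ + p₃ arctan(y₁/y₂) with p₁, p₂, p₃
homogeneous of degree 2l−2+j and p₂(0,y₂) = 0, satisfying ∂(Φ_l)_j/∂y₁ = (Φ_l)_{j−1}. -/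

noncomputable section

/-- `f` has, on the upper half-plane, the form
`p₁ log(y₁²+y₂²) + p₂ + p₃ arctan(y₁/y₂)` with `p₁, p₂, p₃` homogeneous polynomials of
degree `d` and `p₂(0, y₂) = 0`. -/
def UpperHalfPlaneForm (d : ℕ) (f : ℝ × ℝ → ℂ) : Prop :=
  ∃ p₁ p₂ p₃ : MvPolynomial (Fin 2) ℂ,
    p₁.IsHomogeneous d ∧ p₂.IsHomogeneous d ∧ p₃.IsHomogeneous d ∧
    (∀ y₂ : ℝ, MvPolynomial.eval ![(0 : ℂ), (y₂ : ℂ)] p₂ = 0) ∧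
    ∀ y : ℝ × ℝ, 0 < y.2 →
      f y = MvPolynomial.eval ![(y.1 : ℂ), (y.2 : ℂ)] p₁ *
              ((Real.log (y.1 ^ 2 + y.2 ^ 2) : ℝ) : ℂ)
          + MvPolynomial.eval ![(y.1 : ℂ), (y.2 : ℂ)] p₂
          + MvPolynomial.eval ![(y.1 : ℂ), (y.2 : ℂ)] p₃ *
              ((Real.arctan (y.1 / y.2) : ℝ) : ℂ)

/-- The defining property of the chain `((Φ_l)_j)_{j ≥ 0}` of `y₁`-antiderivatives of
`Φ_l` on the upper half-plane. -/
def AntiderivChain (l : ℕ) (Φl : ℝ × ℝ → ℂ) (Ψ : ℕ → (ℝ × ℝ → ℂ)) : Prop :=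
  (∀ y : ℝ × ℝ, 0 < y.2 → Ψ 0 y = Φl y) ∧
  ∀ j : ℕ, 1 ≤ j →
    UpperHalfPlaneForm (2 * l - 2 + j) (Ψ j) ∧
    ∀ y : ℝ × ℝ, 0 < y.2 →
      fderiv ℝ (Ψ j) y ((1 : ℝ), (0 : ℝ)) = Ψ (j - 1) y

open Polynomial Filter Topology

/-- The homogenization of `P 0 log + P 1 + P 2 arctan` in degree `d`: the polynomials are evaluated
at `y₁ / y₂` and rescaled by `y₂ ^ d`. -/
def logArctanForm (d : ℕ) (P : Fin 3 → ℂ[X]) (y : ℝ × ℝ) : ℂ :=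
  (y.2 : ℂ) ^ d * ((P 0).eval ((y.1 / y.2 : ℝ) : ℂ) * ((Real.log (y.1 ^ 2 + y.2 ^ 2) : ℝ) : ℂ)
    + (P 1).eval ((y.1 / y.2 : ℝ) : ℂ)
    + (P 2).eval ((y.1 / y.2 : ℝ) : ℂ) * ((Real.arctan (y.1 / y.2) : ℝ) : ℂ))

lemma exists_natDegree_le_homogenize_eq {d : ℕ} {q : MvPolynomial (Fin 2) ℂ}
    (hq : q.IsHomogeneous d) : ∃ p : ℂ[X], p.natDegree ≤ d ∧ p.homogenize d = q := by
  refine ⟨MvPolynomial.aeval ![X, 1] q, ?_, homogenize_eq_of_isHomogeneous hq rfl⟩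
  rw [q.as_sum, map_sum]
  refine natDegree_sum_le_of_forall_le _ _ fun m hm => ?_
  have hmd : m 0 + m 1 = d := by
    have := hq (MvPolynomial.mem_support_iff.mp hm)
    simpa [Finsupp.weight_apply, Finsupp.sum_fintype, Fin.sum_univ_two] using this
  simp only [MvPolynomial.aeval_monomial, ← C_eq_algebraMap, Finsupp.prod_fintype, Fin.prod_univ_two,
    Matrix.cons_val_zero, Matrix.cons_val_one, one_pow, mul_one, pow_zero, implies_true]
  exact (natDegree_C_mul_X_pow_le _ _).trans (by omega)

lemma eval_homogenize_ofReal {d : ℕ} {p : ℂ[X]} (hp : p.natDegree ≤ d) {y : ℝ × ℝ}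
    (hy : 0 < y.2) :
    MvPolynomial.eval ![(y.1 : ℂ), (y.2 : ℂ)] (p.homogenize d) =
      (y.2 : ℂ) ^ d * p.eval ((y.1 / y.2 : ℝ) : ℂ) := by
  rw [eval_homogenize hp _ (by simpa using hy.ne')]
  simp [mul_comm]

lemma upperHalfPlaneForm_iff {d : ℕ} {f : ℝ × ℝ → ℂ} :
    UpperHalfPlaneForm d f ↔ ∃ P : Fin 3 → ℂ[X], (∀ i, (P i).natDegree ≤ d) ∧
      (P 1).eval 0 = 0 ∧ ∀ y : ℝ × ℝ, 0 < y.2 → f y = logArctanForm d P y := by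
  constructor
  · rintro ⟨p₁, p₂, p₃, h₁, h₂, h₃, h0, hf⟩
    obtain ⟨P₁, hP₁, rfl⟩ := exists_natDegree_le_homogenize_eq h₁
    obtain ⟨P₂, hP₂, rfl⟩ := exists_natDegree_le_homogenize_eq h₂
    obtain ⟨P₃, hP₃, rfl⟩ := exists_natDegree_le_homogenize_eq h₃
    refine ⟨![P₁, P₂, P₃], ?_, ?_, fun y hy => ?_⟩
    · intro i; fin_cases i <;> assumption
    · have := h0 1
      rw [eval_homogenize hP₂ _ (by simp)] at this
      simpa using this
    · rw [hf y hy, eval_homogenize_ofReal hP₁ hy, eval_homogenize_ofReal hP₂ hy,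
        eval_homogenize_ofReal hP₃ hy]
      simp only [logArctanForm, Matrix.cons_val]
      ring
  · rintro ⟨P, hP, h0, hf⟩
    refine ⟨(P 0).homogenize d, (P 1).homogenize d, (P 2).homogenize d,
      isHomogeneous_homogenize _, isHomogeneous_homogenize _, isHomogeneous_homogenize _,
      fun t => ?_, fun y hy => ?_⟩
    · obtain ⟨g, hg⟩ : (X : ℂ[X]) ∣ P 1 := by
        rw [X_dvd_iff, coeff_zero_eq_eval_zero, h0]
      rcases eq_or_ne g 0 with rfl | hg0
      · simp [hg]
      have hd : g.natDegree + 1 ≤ d := by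
        simpa [hg, natDegree_X_mul hg0] using hP 1
      obtain ⟨e, rfl⟩ : ∃ e, d = 1 + e := ⟨d - 1, by omega⟩
      rw [hg, homogenize_mul X g natDegree_X_le (by omega)]
      simp [homogenize_X]
    · rw [hf y hy, eval_homogenize_ofReal (hP 0) hy, eval_homogenize_ofReal (hP 1) hy,
        eval_homogenize_ofReal (hP 2) hy]
      simp only [logArctanForm]
      ring

lemma logArctanForm_sub (d : ℕ) (P Q : Fin 3 → ℂ[X]) (y : ℝ × ℝ) :
    logArctanForm d (P - Q) y = logArctanForm d P y - logArctanForm d Q y := by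
  simp only [logArctanForm, Pi.sub_apply, eval_sub]
  ring

lemma differentiableAt_logArctanForm (d : ℕ) (P : Fin 3 → ℂ[X]) {y : ℝ × ℝ} (hy : 0 < y.2) :
    DifferentiableAt ℝ (logArctanForm d P) y := by
  have hu : DifferentiableAt ℝ (fun z : ℝ × ℝ => z.1 / z.2) y :=
    differentiableAt_fst.fun_mul (differentiableAt_snd.inv hy.ne')
  have hofReal {g : ℝ × ℝ → ℝ} (hg : DifferentiableAt ℝ g y) :
      DifferentiableAt ℝ (fun z => (g z : ℂ)) y :=
    Complex.ofRealCLM.differentiableAt.comp y hg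
  have heval (p : ℂ[X]) : DifferentiableAt ℝ (fun z : ℝ × ℝ => p.eval ((z.1 / z.2 : ℝ) : ℂ)) y :=
    (p.differentiable.differentiableAt.restrictScalars ℝ).comp y (hofReal hu)
  have hlog : DifferentiableAt ℝ (fun z : ℝ × ℝ => Real.log (z.1 ^ 2 + z.2 ^ 2)) y :=
    ((differentiableAt_fst.pow 2).add (differentiableAt_snd.pow 2)).log
      (show y.1 ^ 2 + y.2 ^ 2 ≠ 0 by positivity)
  exact ((hofReal differentiableAt_snd).pow d).mul
    ((((heval _).mul (hofReal hlog)).add (heval _)).add ((heval _).mul (hofReal hu.arctan)))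

/-- The polynomial relation expressing that `Q` is an antiderivative of `P` in the class
`P 0 log + P 1 + P 2 arctan`. -/
def IsAntideriv (Q P : Fin 3 → ℂ[X]) : Prop :=
  derivative (Q 0) = P 0 ∧ derivative (Q 2) = P 2 ∧
    (1 + X ^ 2) * derivative (Q 1) + 2 * X * Q 0 + Q 2 = (1 + X ^ 2) * P 1

lemma fderiv_logArctanForm {d : ℕ} {P Q : Fin 3 → ℂ[X]} (h : IsAntideriv Q P) {y : ℝ × ℝ}
    (hy : 0 < y.2) :
    fderiv ℝ (logArctanForm (d + 1) Q) y ((1 : ℝ), (0 : ℝ)) = logArctanForm d P y := by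
  obtain ⟨h0, h2, h1⟩ := h
  obtain ⟨x, t⟩ := y
  replace hy : 0 < t := hy
  have hline : HasDerivAt (fun s : ℝ => (s, t)) ((1 : ℝ), (0 : ℝ)) x :=
    (hasDerivAt_id x).prodMk (hasDerivAt_const x t)
  have key := (differentiableAt_logArctanForm (d + 1) Q (y := (x, t)) hy).hasFDerivAt.comp_hasDerivAt
    x hline
  refine key.unique ?_
  have hu : HasDerivAt (fun s : ℝ => s / t) (1 / t) x := (hasDerivAt_id x).div_const t
  have heval (p : ℂ[X]) : HasDerivAt (fun s : ℝ => p.eval ((s / t : ℝ) : ℂ))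
      ((1 / t : ℝ) • p.derivative.eval ((x / t : ℝ) : ℂ)) x :=
    ((p.hasDerivAt _).comp_ofReal).scomp x hu
  have hpos : x ^ 2 + t ^ 2 ≠ 0 := by positivity
  have hlog : HasDerivAt (fun s : ℝ => Real.log (s ^ 2 + t ^ 2)) (2 * x / (x ^ 2 + t ^ 2)) x := by
    simpa using ((hasDerivAt_pow 2 x).add_const (t ^ 2)).log hpos
  have hD := ((((heval (Q 0)).mul hlog.ofReal_comp).add (heval (Q 1))).add
    ((heval (Q 2)).mul hu.arctan.ofReal_comp)).const_mul ((t : ℂ) ^ (d + 1))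
  refine hD.congr_deriv ?_
  have e1 := congrArg (Polynomial.eval ((x / t : ℝ) : ℂ)) h1
  simp only [eval_add, eval_mul, eval_pow, eval_X, eval_one, eval_ofNat] at e1
  simp only [logArctanForm, h0, h2, Complex.real_smul]
  have ht : (t : ℂ) ≠ 0 := by exact_mod_cast hy.ne'
  have hposC : (t : ℂ) ^ 2 + (x : ℂ) ^ 2 ≠ 0 := by
    rw [add_comm]
    exact_mod_cast hpos
  generalize Polynomial.eval ((x / t : ℝ) : ℂ) (Q 0) = q0 at *
  generalize Polynomial.eval ((x / t : ℝ) : ℂ) (Q 2) = q2 at *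
  generalize Polynomial.eval ((x / t : ℝ) : ℂ) (derivative (Q 1)) = q1 at *
  generalize Polynomial.eval ((x / t : ℝ) : ℂ) (P 1) = p1 at *
  push_cast at e1 ⊢
  rw [add_comm ((x : ℂ) ^ 2)]
  field_simp at e1 ⊢
  linear_combination (t : ℂ) ^ (d + 1) * e1

lemma exists_derivative_eq (p : ℂ[X]) : ∃ q : ℂ[X], derivative q = p ∧ q.eval 0 = 0 := by
  induction p using Polynomial.induction_on' with
  | add p q hp hq =>
    obtain ⟨p', hp, hp0⟩ := hp
    obtain ⟨q', hq, hq0⟩ := hq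
    exact ⟨p' + q', by simp [hp, hq], by simp [hp0, hq0]⟩
  | monomial n a =>
    refine ⟨monomial (n + 1) (a / (n + 1)), ?_, by simp⟩
    have : (n : ℂ) + 1 ≠ 0 := by exact_mod_cast n.succ_ne_zero
    rw [derivative_monomial_succ, div_mul_cancel₀ _ this]

lemma natDegree_le_of_derivative {p : ℂ[X]} {d : ℕ} (h : p.derivative.natDegree ≤ d) :
    p.natDegree ≤ d + 1 := by
  rw [natDegree_derivative] at h
  omega

lemma one_add_X_sq_dvd {p : ℂ[X]} (h : p.eval Complex.I = 0) (h' : p.eval (-Complex.I) = 0) :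
    1 + X ^ 2 ∣ p := by
  have hfac : (1 + X ^ 2 : ℂ[X]) = (X - C Complex.I) * (X - C (-Complex.I)) := by
    have hI : C Complex.I * C Complex.I = (-1 : ℂ[X]) := by
      rw [← C_mul, Complex.I_mul_I, C_neg, C_1]
    rw [C_neg]
    linear_combination hI
  have hne : Complex.I ≠ -Complex.I := by
    simp [eq_neg_iff_add_eq_zero, ← two_mul]
  rw [hfac]
  exact (isCoprime_X_sub_C_of_isUnit_sub (sub_ne_zero.mpr hne).isUnit).mul_dvd
    (dvd_iff_isRoot.mpr h) (dvd_iff_isRoot.mpr h')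

lemma exists_isAntideriv (P : Fin 3 → ℂ[X]) :
    ∃ Q : Fin 3 → ℂ[X], IsAntideriv Q P ∧ (Q 1).eval 0 = 0 ∧
      ∀ d, (∀ i, (P i).natDegree ≤ d) → ∀ i, (Q i).natDegree ≤ d + 1 := by
  obtain ⟨A, hA, -⟩ := exists_derivative_eq (P 0)
  obtain ⟨B, hB, -⟩ := exists_derivative_eq (P 2)
  obtain ⟨a, b, h, h'⟩ : ∃ a b : ℂ,
      2 * Complex.I * (A.eval Complex.I + a) + (B.eval Complex.I + b) = 0 ∧
      2 * (-Complex.I) * (A.eval (-Complex.I) + a) + (B.eval (-Complex.I) + b) = 0 := by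
    refine ⟨-(2 * Complex.I * (A.eval Complex.I + A.eval (-Complex.I))
      + B.eval Complex.I - B.eval (-Complex.I)) / (4 * Complex.I),
      -(2 * Complex.I * (A.eval Complex.I - A.eval (-Complex.I))
      + B.eval Complex.I + B.eval (-Complex.I)) / 2, ?_, ?_⟩ <;>
    · field_simp [Complex.I_ne_zero]
      ring
  obtain ⟨S, hS⟩ : 1 + X ^ 2 ∣ 2 * X * (A + C a) + (B + C b) :=
    one_add_X_sq_dvd (by simpa using h) (by simpa using h')
  obtain ⟨R, hR, hR0⟩ := exists_derivative_eq (P 1 - S)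
  refine ⟨![A + C a, R, B + C b], ⟨by simpa using hA, by simpa using hB, ?_⟩, hR0, ?_⟩
  · simp only [Matrix.cons_val, hR]
    linear_combination hS
  · intro d hd
    have hA' : (A + C a).natDegree ≤ d + 1 :=
      natDegree_le_of_derivative (by simpa [hA] using hd 0)
    have hB' : (B + C b).natDegree ≤ d + 1 :=
      natDegree_le_of_derivative (by simpa [hB] using hd 2)
    have hS' : S.natDegree ≤ d := by
      rcases eq_or_ne S 0 with rfl | hS0
      · simp
      have hX : (1 + X ^ 2 : ℂ[X]).natDegree = 2 := by compute_degree!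
      have hX0 : (1 + X ^ 2 : ℂ[X]) ≠ 0 := fun h0 => by simp [h0] at hX
      have hmul := natDegree_mul hX0 hS0
      have hle : (2 * X * (A + C a) + (B + C b)).natDegree ≤ d + 2 := by
        refine natDegree_add_le_of_degree_le ?_ (by omega)
        refine natDegree_mul_le.trans ?_
        have : (2 * X : ℂ[X]).natDegree ≤ 1 := by compute_degree!
        omega
      rw [hS, hmul, hX] at hle
      omega
    have hR' : R.natDegree ≤ d + 1 :=
      natDegree_le_of_derivative (hR ▸ (natDegree_sub_le_of_le (hd 1) hS').trans (by simp))
    intro i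
    fin_cases i <;> assumption

lemma tendsto_eval_div_pow_atTop {p : ℂ[X]} {N : ℕ} (hp : p.natDegree ≤ N) :
    Tendsto (fun x : ℝ => p.eval (x : ℂ) / (x : ℂ) ^ N) atTop (𝓝 (p.coeff N)) := by
  have hinv : Tendsto (fun x : ℝ => ((x⁻¹ : ℝ) : ℂ)) atTop (𝓝 0) := by
    exact (Complex.continuous_ofReal.tendsto' 0 0 Complex.ofReal_zero).comp tendsto_inv_atTop_zero
  have hlim := ((reflect N p).continuous.tendsto 0).comp hinv
  rw [← coeff_zero_eq_eval_zero, coeff_reflect, revAt_le N.zero_le, Nat.sub_zero] at hlim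
  refine hlim.congr' ?_
  filter_upwards [eventually_gt_atTop 0] with x hx
  have hx' : (x : ℂ) ≠ 0 := by exact_mod_cast hx.ne'
  let := invertibleOfNonzero hx'
  have := eval₂_reflect_mul_pow (RingHom.id ℂ) (x : ℂ) N p hp
  rw [eq_div_iff (pow_ne_zero _ hx')]
  simpa [eval₂_id] using this

lemma tendsto_log_one_add_sq_div_pow_atTop {N : ℕ} (hN : 1 ≤ N) :
    Tendsto (fun x : ℝ => Real.log (1 + x ^ 2) / x ^ N) atTop (𝓝 0) := by
  have hsq : Tendsto (fun x : ℝ => 1 + x ^ 2) atTop atTop :=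
    tendsto_atTop_add_const_left _ _ (tendsto_pow_atTop two_ne_zero)
  have h1 := (isLittleO_log_rpow_atTop (r := 1 / 2) (by norm_num)).comp_tendsto hsq
  have h2 : ((fun x : ℝ => x ^ (1 / 2 : ℝ)) ∘ fun x : ℝ => 1 + x ^ 2) =O[atTop]
      fun x : ℝ => x ^ N := by
    refine Asymptotics.IsBigO.of_bound 2 ?_
    filter_upwards [eventually_ge_atTop 1] with x hx
    rw [Function.comp_apply, ← Real.sqrt_eq_rpow, Real.norm_of_nonneg (Real.sqrt_nonneg _),
      Real.norm_of_nonneg (by positivity)]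
    calc √(1 + x ^ 2) ≤ 2 * x := Real.sqrt_le_iff.mpr ⟨by positivity, by nlinarith⟩
      _ ≤ 2 * x ^ N := by gcongr; exact le_self_pow₀ hx (by omega)
  exact (h1.trans_isBigO h2).tendsto_div_nhds_zero

lemma coeff_add_pi_div_two_mul_coeff_eq_zero {a : ℂ} {q p : ℂ[X]} {N : ℕ} (hN : 1 ≤ N)
    (hq : q.natDegree ≤ N) (hp : p.natDegree ≤ N)
    (h : ∀ x : ℝ, a * ((Real.log (1 + x ^ 2) : ℝ) : ℂ) + q.eval (x : ℂ)
      + p.eval (x : ℂ) * ((Real.arctan x : ℝ) : ℂ) = 0) :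
    q.coeff N + p.coeff N * ((Real.pi / 2 : ℝ) : ℂ) = 0 := by
  have hlog := (Complex.continuous_ofReal.tendsto 0).comp (tendsto_log_one_add_sq_div_pow_atTop hN)
  have hatan := (Complex.continuous_ofReal.tendsto _).comp
    (Real.tendsto_arctan_atTop.mono_right nhdsWithin_le_nhds)
  have hlim := ((hlog.const_mul a).add (tendsto_eval_div_pow_atTop hq)).add
    ((tendsto_eval_div_pow_atTop hp).mul hatan)
  rw [Complex.ofReal_zero, mul_zero, zero_add] at hlim
  refine tendsto_nhds_unique (hlim.congr fun x => ?_) tendsto_const_nhds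
  simp only [Function.comp_apply, Complex.ofReal_div, Complex.ofReal_pow]
  rw [← zero_div ((x : ℂ) ^ N), ← h x]
  ring

/-- A relation `a log(1 + x²) + q(x) + p(x) arctan x = 0` forces `a = 0`. -/
lemma eq_zero_of_log_arctan_relation {a : ℂ} {q p : ℂ[X]}
    (h : ∀ x : ℝ, a * ((Real.log (1 + x ^ 2) : ℝ) : ℂ) + q.eval (x : ℂ)
      + p.eval (x : ℂ) * ((Real.arctan x : ℝ) : ℂ) = 0) : a = 0 := by
  have hcoeff : ∀ N, 1 ≤ N → q.natDegree ≤ N → p.natDegree ≤ N →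
      q.coeff N = 0 ∧ p.coeff N = 0 := by
    intro N hN hq hp
    have h1 := coeff_add_pi_div_two_mul_coeff_eq_zero hN hq hp h
    have h2 := coeff_add_pi_div_two_mul_coeff_eq_zero (a := a) (q := q.comp (-X))
      (p := -p.comp (-X)) hN (by simpa [natDegree_comp] using hq)
      (by simpa [natDegree_comp] using hp) (fun x => by
        have := h (-x)
        simpa [Real.arctan_neg] using this)
    rw [coeff_neg, show (-X : ℂ[X]) = C (-1) * X by simp, comp_C_mul_X_coeff,
      comp_C_mul_X_coeff] at h2
    have hsign : ((-1 : ℂ) ^ N) ≠ 0 := pow_ne_zero _ (by norm_num)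
    have h2' : q.coeff N - p.coeff N * ((Real.pi / 2 : ℝ) : ℂ) = 0 :=
      mul_left_cancel₀ hsign (by linear_combination h2)
    have hpi : ((Real.pi / 2 : ℝ) : ℂ) ≠ 0 := by exact_mod_cast (by positivity)
    have hp0 : p.coeff N * ((Real.pi / 2 : ℝ) : ℂ) = 0 := by
      linear_combination (h1 - h2') / 2
    exact ⟨by linear_combination (h1 + h2') / 2, (mul_eq_zero.mp hp0).resolve_right hpi⟩
  have hdeg : q.natDegree = 0 ∧ p.natDegree = 0 := by
    by_contra hne
    have hN : 1 ≤ max q.natDegree p.natDegree := by omega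
    obtain ⟨hq, hp⟩ := hcoeff _ hN (le_max_left _ _) (le_max_right _ _)
    rcases le_total q.natDegree p.natDegree with hle | hle
    · rw [max_eq_right hle, coeff_natDegree, leadingCoeff_eq_zero] at hp
      simp [hp] at hle hne
      exact hne hle
    · rw [max_eq_left hle, coeff_natDegree, leadingCoeff_eq_zero] at hq
      simp [hq] at hle hne
      exact hne hle
  rw [eq_C_of_natDegree_eq_zero hdeg.1, eq_C_of_natDegree_eq_zero hdeg.2] at h
  have h0 := h 0
  have h1 := h 1
  have h2 := h (-1)
  simp only [eval_C, Real.arctan_neg, Real.arctan_zero] at h0 h1 h2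
  norm_num at h0 h1 h2
  have hlog : (Real.log 2 : ℂ) ≠ 0 := by exact_mod_cast (Real.log_pos one_lt_two).ne'
  have : a * (Real.log 2 : ℂ) = 0 := by
    rw [← Complex.ofReal_ofNat, ← Complex.ofReal_log zero_le_two] at h1 h2
    linear_combination (h1 + h2) / 2 - h0
  exact (mul_eq_zero.mp this).resolve_right hlog

lemma logArctanForm_eq_zero {d : ℕ} {P : Fin 3 → ℂ[X]} (h0 : (P 1).eval 0 = 0)
    (hP : ∀ y : ℝ × ℝ, 0 < y.2 → fderiv ℝ (logArctanForm d P) y ((1 : ℝ), (0 : ℝ)) = 0)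
    {y : ℝ × ℝ} (hy : 0 < y.2) : logArctanForm d P y = 0 := by
  have hconst (x : ℝ) {t : ℝ} (ht : 0 < t) :
      logArctanForm d P (x, t) = logArctanForm d P (0, t) := by
    have hline (s : ℝ) : HasDerivAt (fun s : ℝ => logArctanForm d P (s, t)) 0 s := by
      have := (differentiableAt_logArctanForm d P (y := (s, t)) ht).hasFDerivAt.comp_hasDerivAt s
        ((hasDerivAt_id s).prodMk (hasDerivAt_const s t))
      rwa [hP _ ht] at this
    exact is_const_of_deriv_eq_zero (fun s => (hline s).differentiableAt)
      (fun s => (hline s).deriv) x 0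
  have hrel (u : ℝ) {t : ℝ} (ht : 0 < t) :
      (P 0).eval (u : ℂ) * ((Real.log (1 + u ^ 2) : ℝ) + 2 * (Real.log t : ℝ) : ℂ)
        + (P 1).eval (u : ℂ) + (P 2).eval (u : ℂ) * ((Real.arctan u : ℝ) : ℂ)
        = (P 0).eval 0 * (2 * (Real.log t : ℝ) : ℂ) := by
    have htC : ((t : ℂ) ^ d) ≠ 0 := pow_ne_zero _ (by exact_mod_cast ht.ne')
    have h := hconst (u * t) ht
    have hl : Real.log ((u * t) ^ 2 + t ^ 2) = Real.log (1 + u ^ 2) + 2 * Real.log t := by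
      rw [show (u * t) ^ 2 + t ^ 2 = (1 + u ^ 2) * t ^ 2 by ring,
        Real.log_mul (by positivity) (by positivity), Real.log_pow]
      norm_num
    have hl0 : Real.log ((0 : ℝ) ^ 2 + t ^ 2) = 2 * Real.log t := by
      rw [zero_pow two_ne_zero, zero_add, Real.log_pow]
      norm_num
    simp only [logArctanForm, mul_div_cancel_right₀ _ ht.ne', hl, hl0, zero_div,
      Complex.ofReal_zero, h0, Real.arctan_zero, mul_zero, add_zero] at h
    have h := mul_left_cancel₀ htC h
    push_cast at h ⊢
    exact h
  have hP0 (u : ℝ) : (P 0).eval (u : ℂ) = (P 0).eval 0 := by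
    have h1 := hrel u one_pos
    have h2 := hrel u (Real.exp_pos 1)
    rw [Real.log_one] at h1
    rw [Real.log_exp] at h2
    push_cast at h1 h2
    linear_combination (h2 - h1) / 2
  have ha : (P 0).eval 0 = 0 := by
    refine eq_zero_of_log_arctan_relation (q := P 1) (p := P 2) fun x => ?_
    have h1 := hrel x one_pos
    rw [hP0, Real.log_one] at h1
    simpa using h1
  obtain ⟨x, t⟩ := y
  rw [hconst x hy]
  simp [logArctanForm, ha, h0]

theorem antiderivative_chain_exists_unique
    (l : ℕ) (hl : 1 ≤ l) (Φl : ℝ × ℝ → ℂ)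
    (hΦl : ∃ p q : MvPolynomial (Fin 2) ℂ,
      p.IsHomogeneous (2 * l - 2) ∧ q.IsHomogeneous (2 * l - 2) ∧
      ∀ y : ℝ × ℝ, 0 < y.2 →
        Φl y = MvPolynomial.eval ![(y.1 : ℂ), (y.2 : ℂ)] p *
              ((Real.log (y.1 ^ 2 + y.2 ^ 2) : ℝ) : ℂ)
            + MvPolynomial.eval ![(y.1 : ℂ), (y.2 : ℂ)] q) :
    ∃ Ψ : ℕ → (ℝ × ℝ → ℂ), AntiderivChain l Φl Ψ ∧
      ∀ Ψ' : ℕ → (ℝ × ℝ → ℂ), AntiderivChain l Φl Ψ' →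
        ∀ j : ℕ, ∀ y : ℝ × ℝ, 0 < y.2 → Ψ' j y = Ψ j y := by
  obtain ⟨p, q, hp, hq, hpq⟩ := hΦl
  obtain ⟨A, hA, rfl⟩ := exists_natDegree_le_homogenize_eq hp
  obtain ⟨B, hB, rfl⟩ := exists_natDegree_le_homogenize_eq hq
  choose prim hprim hnorm hdeg using exists_isAntideriv
  set P : ℕ → Fin 3 → ℂ[X] := fun j => prim^[j] ![A, B, 0] with hPdef
  have hsucc (j : ℕ) : P (j + 1) = prim (P j) := Function.iterate_succ_apply' _ _ _
  have hPdeg (j : ℕ) : ∀ i, (P j i).natDegree ≤ 2 * l - 2 + j := by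
    induction j with
    | zero =>
      intro i
      fin_cases i
      · exact hA
      · exact hB
      · simp [hPdef]
    | succ j ih =>
      rw [hsucc]
      exact hdeg _ _ ih
  refine ⟨fun j => logArctanForm (2 * l - 2 + j) (P j), ⟨fun y hy => ?_, fun j hj => ?_⟩, ?_⟩
  · rw [hpq y hy, eval_homogenize_ofReal hA hy, eval_homogenize_ofReal hB hy]
    simp [hPdef, logArctanForm]
    ring
  · obtain ⟨k, rfl⟩ : ∃ k, j = k + 1 := ⟨j - 1, by omega⟩
    refine ⟨upperHalfPlaneForm_iff.mpr ⟨P (k + 1), hPdeg _, ?_, fun y _ => rfl⟩, fun y hy => ?_⟩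
    · rw [hsucc]
      exact hnorm _
    · refine fderiv_logArctanForm ?_ hy
      rw [hsucc]
      exact hprim _
  · rintro Ψ' ⟨h0, hstep⟩ j
    induction j with
    | zero =>
      intro y hy
      rw [h0 y hy, hpq y hy, eval_homogenize_ofReal hA hy, eval_homogenize_ofReal hB hy]
      simp [hPdef, logArctanForm]
      ring
    | succ k ih =>
      intro y hy
      obtain ⟨hform, hder⟩ := hstep (k + 1) (by omega)
      obtain ⟨Q, -, hQ0, hQ⟩ := upperHalfPlaneForm_iff.mp hform
      have hopen : IsOpen {y : ℝ × ℝ | 0 < y.2} := isOpen_lt continuous_const continuous_snd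
      rw [hQ y hy, ← sub_eq_zero, ← logArctanForm_sub]
      refine logArctanForm_eq_zero ?_ (fun z hz => ?_) hy
      · rw [Pi.sub_apply, eval_sub, hQ0, hsucc, hnorm, sub_zero]
      · have hev : Ψ' (k + 1) =ᶠ[𝓝 z] logArctanForm (2 * l - 2 + (k + 1)) Q := by
          filter_upwards [hopen.mem_nhds hz] with w hw using hQ w hw
        have h1 := hder z hz
        rw [hev.fderiv_eq, Nat.add_sub_cancel, ih z hz] at h1
        have h2 : fderiv ℝ (logArctanForm (2 * l - 2 + (k + 1)) (P (k + 1))) z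
            ((1 : ℝ), (0 : ℝ)) = logArctanForm (2 * l - 2 + k) (P k) z :=
          fderiv_logArctanForm (by rw [hsucc]; exact hprim _) hz
        rw [show logArctanForm (2 * l - 2 + (k + 1)) (Q - P (k + 1)) =
            logArctanForm (2 * l - 2 + (k + 1)) Q -
              logArctanForm (2 * l - 2 + (k + 1)) (P (k + 1)) from
            funext (logArctanForm_sub _ _ _),
          fderiv_sub (differentiableAt_logArctanForm _ _ hz)
            (differentiableAt_logArctanForm _ _ hz),
          _root_.sub_apply, h1, h2, sub_self]
end
end

section
/- Let Ω = 𝔻₁ × 𝔻₂ ⊂ ℂ² be the bi-disc. Let g : closure(Ω) → ℂ be smooth and let v ∈ C²(Ω) ∩ C(closure(Ω)) satisfy Δv = g in Ω and v = 0 on ∂Ω. Then for every open set V ⊂ ℂ² with V ∩ (∂𝔻₁ × ∂𝔻₂) = ∅, the function v is C^∞ on V ∩ closure(Ω): all partial derivatives of v of every order extend continuously from V ∩ Ω to V ∩ closure(Ω). -/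
/- STATEMENT 13: the solution of the Dirichlet problem Δv = g, v|_{∂Ω} = 0 on the bi-disc
with smooth data is C^∞ up to the boundary on any open set avoiding the distinguished
boundary ∂𝔻₁ × ∂𝔻₂. -/

noncomputable section

/-- The bi-disc `𝔻 × 𝔻 ⊂ ℂ²`. -/
def biDisc : Set (ℂ × ℂ) := {z | ‖z.1‖ < 1 ∧ ‖z.2‖ < 1}

/-- The distinguished boundary `∂𝔻₁ × ∂𝔻₂` of the bi-disc. -/
def distBoundary : Set (ℂ × ℂ) := {z | ‖z.1‖ = 1 ∧ ‖z.2‖ = 1}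

/-- The real Laplacian on `ℂ × ℂ ≅ ℝ⁴`. -/
def lap (u : ℂ × ℂ → ℂ) (z : ℂ × ℂ) : ℂ :=
    fderiv ℝ (fun w => fderiv ℝ u w ((1 : ℂ), (0 : ℂ))) z ((1 : ℂ), (0 : ℂ))
  + fderiv ℝ (fun w => fderiv ℝ u w (Complex.I, (0 : ℂ))) z (Complex.I, (0 : ℂ))
  + fderiv ℝ (fun w => fderiv ℝ u w ((0 : ℂ), (1 : ℂ))) z ((0 : ℂ), (1 : ℂ))
  + fderiv ℝ (fun w => fderiv ℝ u w ((0 : ℂ), Complex.I)) z ((0 : ℂ), Complex.I)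

open Set Filter Topology MeasureTheory
open scoped ContDiff FourierTransform

/-- Maximum principle in one variable: a function that is strictly convex wherever it is positive
is bounded by zero if it is so at both ends. -/
lemma nonpos_of_convex_where_pos {a b : ℝ} {f f' f'' : ℝ → ℝ}
    (hf : ContinuousOn f (Icc a b))
    (h1 : ∀ t ∈ Ioo a b, HasDerivAt f (f' t) t)
    (h2 : ∀ t ∈ Ioo a b, HasDerivAt f' (f'' t) t)
    (hpos : ∀ t ∈ Ioo a b, 0 < f t → 0 < f'' t) (ha : f a ≤ 0) (hb : f b ≤ 0) :
    ∀ t ∈ Icc a b, f t ≤ 0 := by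
  intro t ht
  by_contra! hcon
  obtain ⟨s, hs, hmax⟩ := isCompact_Icc.exists_isMaxOn ⟨t, ht⟩ hf
  have hsp : 0 < f s := hcon.trans_le (hmax ht)
  have hsI : s ∈ Ioo a b := by
    refine ⟨lt_of_le_of_ne hs.1 ?_, lt_of_le_of_ne hs.2 ?_⟩
    · rintro rfl; linarith
    · rintro rfl; linarith
  have hnear : Ioo a b ∈ 𝓝 s := Ioo_mem_nhds hsI.1 hsI.2
  have hlm : IsLocalMax f s := hmax.isLocalMax (mem_of_superset hnear Ioo_subset_Icc_self)
  have hd : deriv f =ᶠ[𝓝 s] f' := by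
    filter_upwards [hnear] with x hx using (h1 x hx).deriv
  have hdd : deriv (deriv f) s = f'' s := by
    rw [hd.deriv_eq]; exact (h2 s hsI).deriv
  have hlmin : IsLocalMin f s :=
    isLocalMin_of_deriv_deriv_pos (by rw [hdd]; exact hpos s hsI hsp) hlm.deriv_eq_zero
      (h1 s hsI).continuousAt
  have hconst : f =ᶠ[𝓝 s] fun _ => f s := by
    filter_upwards [hlm, hlmin] with x hx hx' using le_antisymm hx hx'
  have hd0 : deriv f =ᶠ[𝓝 s] fun _ => 0 := by
    filter_upwards [hconst.eventuallyEq_nhds] with x hx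
    rw [hx.deriv_eq]; simp
  have : f'' s = 0 := by rw [← hdd, hd0.deriv_eq]; simp
  linarith [hpos s hsI hsp]

/-- Interior decay estimate for `w'' = q w + h` with `q ≥ l²`. -/
lemma norm_le_of_second_order {a b l H M m : ℝ} {w w' w'' : ℝ → ℂ} {q : ℝ → ℝ} (hl : 0 < l)
    (hH : 0 ≤ H) (hw : ContinuousOn w (Icc a b))
    (h1 : ∀ t ∈ Ioo a b, HasDerivAt w (w' t) t)
    (h2 : ∀ t ∈ Ioo a b, HasDerivAt w' (w'' t) t)
    (hq : ∀ t ∈ Ioo a b, l ^ 2 ≤ q t)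
    (hh : ∀ t ∈ Ioo a b, ‖w'' t - q t * w t‖ ≤ H)
    (ha : ‖w a‖ ≤ M) (hb : ‖w b‖ ≤ m) :
    ∀ t ∈ Icc a b,
      ‖w t‖ ≤ H / l ^ 2 + M * Real.exp (-(l * (t - a))) + m * Real.exp (-(l * (b - t))) := by
  intro t₀ ht₀
  have hM : 0 ≤ M := (norm_nonneg _).trans ha
  have hm : 0 ≤ m := (norm_nonneg _).trans hb
  obtain ⟨c, hc, hcw⟩ : ∃ c : ℂ, ‖c‖ = 1 ∧ c * w t₀ = ‖w t₀‖ := by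
    by_cases h0 : w t₀ = 0
    · exact ⟨1, by simp, by simp [h0]⟩
    · refine ⟨(starRingEnd ℂ) (w t₀) / ‖w t₀‖, ?_, ?_⟩
      · simp [h0]
      · have : (‖w t₀‖ : ℂ) ≠ 0 := by simpa using h0
        rw [div_mul_eq_mul_div, Complex.conj_mul', pow_two, mul_div_assoc, div_self this, mul_one]
  have hre : ∀ z : ℂ, (c * z).re ≤ ‖z‖ := fun z =>
    (Complex.re_le_norm _).trans (by rw [norm_mul, hc, one_mul])
  set B : ℝ → ℝ := fun t =>
    H / l ^ 2 + M * Real.exp (-(l * (t - a))) + m * Real.exp (-(l * (b - t))) with hB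
  set B' : ℝ → ℝ := fun t =>
    M * (Real.exp (-(l * (t - a))) * (-l)) + m * (Real.exp (-(l * (b - t))) * l)
  set B'' : ℝ → ℝ := fun t =>
    M * (Real.exp (-(l * (t - a))) * (-l) * (-l)) + m * (Real.exp (-(l * (b - t))) * l * l)
  have he1 : ∀ t, HasDerivAt (fun t => Real.exp (-(l * (t - a))))
      (Real.exp (-(l * (t - a))) * (-l)) t := fun t => by
    have := ((((hasDerivAt_id t).sub_const a).const_mul l).neg).exp
    simpa using this
  have he2 : ∀ t, HasDerivAt (fun t => Real.exp (-(l * (b - t))))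
      (Real.exp (-(l * (b - t))) * l) t := fun t => by
    have := ((((hasDerivAt_id t).const_sub b).const_mul l).neg).exp
    simpa using this
  have hB1 : ∀ t, HasDerivAt B (B' t) t := fun t =>
    (((he1 t).const_mul M).const_add _).add ((he2 t).const_mul m)
  have hB2 : ∀ t, HasDerivAt B' (B'' t) t := fun t =>
    (((he1 t).mul_const (-l)).const_mul M).add (((he2 t).mul_const l).const_mul m)
  have hder : ∀ {g : ℝ → ℂ} {g' : ℂ} {t : ℝ}, HasDerivAt g g' t →
      HasDerivAt (fun t => (c * g t).re) (c * g').re t := fun h =>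
    Complex.reCLM.hasFDerivAt.comp_hasDerivAt _ (h.const_mul c)
  have hBc : Continuous B := continuous_iff_continuousAt.2 fun t => (hB1 t).continuousAt
  have key := nonpos_of_convex_where_pos (a := a) (b := b) (f := fun t => (c * w t).re - B t)
    (f' := fun t => (c * w' t).re - B' t) (f'' := fun t => (c * w'' t).re - B'' t)
    ((Complex.continuous_re.comp_continuousOn (continuousOn_const.mul hw)).sub hBc.continuousOn)
    (fun t ht => (hder (h1 t ht)).sub (hB1 t)) (fun t ht => (hder (h2 t ht)).sub (hB2 t))
    ?_ ?_ ?_ t₀ ht₀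
  · rw [hcw, Complex.ofReal_re] at key
    linarith
  · intro t ht hpos
    have hqt := hq t ht
    have hl2 : 0 < l ^ 2 := by positivity
    have e1 : (c * w'' t).re = q t * (c * w t).re + (c * (w'' t - q t * w t)).re := by
      have : c * w'' t = (q t : ℂ) * (c * w t) + c * (w'' t - q t * w t) := by ring
      rw [this, Complex.add_re, Complex.re_ofReal_mul]
    have e2 : -H ≤ (c * (w'' t - q t * w t)).re := by
      have h3 := Complex.abs_re_le_norm (c * (w'' t - q t * w t))
      rw [norm_mul, hc, one_mul] at h3
      linarith [neg_abs_le (c * (w'' t - q t * w t)).re, hh t ht]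
    have e3 : B'' t + H ≤ q t * B t := by
      have hE : 0 ≤ M * Real.exp (-(l * (t - a))) + m * Real.exp (-(l * (b - t))) := by positivity
      have : B'' t + H = l ^ 2 * B t := by
        simp only [B'', hB]; field_simp; ring
      rw [this]
      refine mul_le_mul_of_nonneg_right hqt ?_
      simp only [hB]; positivity
    have e4 : 0 < q t * ((c * w t).re - B t) := mul_pos (hl2.trans_le hqt) hpos
    rw [e1]; nlinarith
  · have := hre (w a)
    have hE : 0 ≤ H / l ^ 2 + m * Real.exp (-(l * (b - a))) := by positivity
    simp only [hB, sub_self, mul_zero, neg_zero, Real.exp_zero, mul_one]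
    linarith
  · have := hre (w b)
    have hE : 0 ≤ H / l ^ 2 + M * Real.exp (-(l * (b - a))) := by positivity
    simp only [hB, sub_self, mul_zero, neg_zero, Real.exp_zero, mul_one]
    linarith

/-- A function whose second derivative is `W` is, up to an affine function, the double primitive
of `W`; in particular its first derivative extends continuously. -/
lemma deriv_eq_slope_add_primitive {a b : ℝ} (hab : a < b) {w w' W : ℝ → ℂ}
    (hw : ContinuousOn w (Icc a b)) (hW : Continuous W)
    (h1 : ∀ t ∈ Ioo a b, HasDerivAt w (w' t) t)
    (h2 : ∀ t ∈ Ioo a b, HasDerivAt w' (W t) t) :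
    ∀ t ∈ Ioo a b, w' t =
      (w b - w a - ∫ s in a..b, ∫ x in a..s, W x) / (b - a) + ∫ x in a..t, W x := by
  set P : ℝ → ℂ := fun t => ∫ x in a..t, W x with hP
  set R : ℝ → ℂ := fun t => ∫ x in a..t, P x with hR
  have hPd : ∀ t, HasDerivAt P (W t) t := fun t =>
    intervalIntegral.integral_hasDerivAt_right (hW.intervalIntegrable _ _)
      (hW.stronglyMeasurableAtFilter _ _) hW.continuousAt
  have hPc : Continuous P := continuous_iff_continuousAt.2 fun t => (hPd t).continuousAt
  have hRd : ∀ t, HasDerivAt R (P t) t := fun t =>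
    intervalIntegral.integral_hasDerivAt_right (hPc.intervalIntegrable _ _)
      (hPc.stronglyMeasurableAtFilter _ _) hPc.continuousAt
  have hRc : Continuous R := continuous_iff_continuousAt.2 fun t => (hRd t).continuousAt
  intro t ht
  set k : ℂ := w' t - P t with hk
  have hconst : ∀ s ∈ Ioo a b, w' s - P s = k := by
    intro s hs
    refine (convex_Ioo a b).is_const_of_fderivWithin_eq_zero (𝕜 := ℝ)
      (f := fun s => w' s - P s) (fun x hx => ?_) (fun x hx => ?_) hs ht
    · exact ((h2 x hx).sub (hPd x)).differentiableAt.differentiableWithinAt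
    · rw [fderivWithin_of_isOpen isOpen_Ioo hx]
      have := ((h2 x hx).sub (hPd x)).hasFDerivAt.fderiv
      simp only [sub_self] at this
      rw [show (fun s => w' s - P s) = w' - P from rfl, this]
      ext; simp
  set F : ℝ → ℂ := fun s => w s - R s - (s - a) * k with hF
  have hFc : ContinuousOn F (Icc a b) := by
    refine (hw.sub hRc.continuousOn).sub ?_
    fun_prop
  have hFd : ∀ s ∈ Ioo a b, HasDerivAt F 0 s := fun s hs => by
    have h3 : HasDerivAt (fun s : ℝ => ((s : ℂ) - a) * k) k s := by
      have := (((hasDerivAt_id s).ofReal_comp).sub_const (a : ℂ)).mul_const k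
      simpa using this
    have := ((h1 s hs).sub (hRd s)).sub h3
    rw [show w' s - P s - k = 0 by rw [hconst s hs, sub_self]] at this
    exact this
  have hFab : F b = F a := by
    have := constant_of_has_deriv_right_zero (f := fun s => F s) (a := a) (b := b) ?_ ?_
      b (right_mem_Icc.2 hab.le)
    · exact this
    · exact hFc
    · intro s hs
      rcases eq_or_lt_of_le hs.1 with rfl | hlt
      · refine (hasDerivWithinAt_Ici_of_tendsto_deriv (s := Ioo a b) ?_ ?_ ?_ ?_)
        · exact fun x hx => (hFd x hx).differentiableAt.differentiableWithinAt
        · exact (hFc a (left_mem_Icc.2 hab.le)).mono Ioo_subset_Icc_self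
        · exact Ioo_mem_nhdsGT hab
        · refine tendsto_const_nhds.congr' ?_
          filter_upwards [Ioo_mem_nhdsGT hab] with x hx
          exact (hFd x hx).deriv.symm
      · exact (hFd s ⟨hlt, hs.2⟩).hasDerivWithinAt
  have hba : ((b : ℂ) - a) ≠ 0 := by
    rw [← Complex.ofReal_sub]; exact_mod_cast (sub_pos.2 hab).ne'
  have hRa : R a = 0 := by simp [hR]
  have hkey : w b - w a - R b = (b - a) * k := by
    simp only [hF, hRa, sub_self, zero_mul, sub_zero] at hFab
    linear_combination hFab
  change w' t = (w b - w a - R b) / (b - a) + P t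
  rw [hkey, mul_div_cancel_left₀ _ hba, hk]; ring

section Synthesis

variable {E : Type*} [NormedAddCommGroup E]

/-- Functions of `(t, ξ)` which are continuous and rapidly decaying in `ξ`, uniformly in
`t ∈ [a, b]`. -/
def RapidDecay (a b : ℝ) (w : ℝ → E → ℂ) : Prop :=
  ContinuousOn (fun x : ℝ × E => w x.1 x.2) (Icc a b ×ˢ univ) ∧
    ∀ N : ℕ, ∃ C : ℝ, ∀ t ∈ Icc a b, ∀ ξ, (1 + ‖ξ‖) ^ N * ‖w t ξ‖ ≤ C

/-- Functions of `(t, ξ)` whose first `n` derivatives in `t` are rapidly decaying in `ξ`. -/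
def RapidDecayDeriv (a b : ℝ) : ℕ → (ℝ → E → ℂ) → Prop
  | 0, w => RapidDecay a b w
  | n + 1, w => RapidDecay a b w ∧ ∃ w' : ℝ → E → ℂ, RapidDecayDeriv a b n w' ∧
      ∀ ξ, ∀ t ∈ Ioo a b, HasDerivAt (fun s => w s ξ) (w' t ξ) t

variable {a b : ℝ} {w w₁ w₂ : ℝ → E → ℂ} {n : ℕ}

lemma RapidDecayDeriv.rapidDecay (h : RapidDecayDeriv a b n w) : RapidDecay a b w := by
  cases n with
  | zero => exact h
  | succ n => exact h.1

lemma RapidDecayDeriv.of_succ (h : RapidDecayDeriv a b (n + 1) w) : RapidDecayDeriv a b n w := by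
  induction n generalizing w with
  | zero => exact h.1
  | succ n ih =>
    obtain ⟨h0, w', h1, h2⟩ := h
    exact ⟨h0, w', ih h1, h2⟩

lemma RapidDecay.add (h₁ : RapidDecay a b w₁) (h₂ : RapidDecay a b w₂) :
    RapidDecay a b (fun t ξ => w₁ t ξ + w₂ t ξ) := by
  refine ⟨h₁.1.add h₂.1, fun N => ?_⟩
  obtain ⟨C₁, hC₁⟩ := h₁.2 N
  obtain ⟨C₂, hC₂⟩ := h₂.2 N
  refine ⟨C₁ + C₂, fun t ht ξ => ?_⟩
  calc (1 + ‖ξ‖) ^ N * ‖w₁ t ξ + w₂ t ξ‖ ≤ (1 + ‖ξ‖) ^ N * (‖w₁ t ξ‖ + ‖w₂ t ξ‖) := by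
        gcongr; exact norm_add_le _ _
    _ ≤ C₁ + C₂ := by rw [mul_add]; exact add_le_add (hC₁ t ht ξ) (hC₂ t ht ξ)

lemma RapidDecayDeriv.add (h₁ : RapidDecayDeriv a b n w₁) (h₂ : RapidDecayDeriv a b n w₂) :
    RapidDecayDeriv a b n (fun t ξ => w₁ t ξ + w₂ t ξ) := by
  induction n generalizing w₁ w₂ with
  | zero => exact RapidDecay.add h₁ h₂
  | succ n ih =>
    obtain ⟨h0, w', h1, h2⟩ := h₁
    obtain ⟨k0, v', k1, k2⟩ := h₂
    exact ⟨h0.add k0, _, ih h1 k1, fun ξ t ht => (h2 ξ t ht).add (k2 ξ t ht)⟩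

/-- Continuous functions on `E` of at most polynomial growth. -/
def PolyGrowth (p : E → ℂ) : Prop :=
  Continuous p ∧ ∃ (A : ℝ) (k : ℕ), ∀ ξ, ‖p ξ‖ ≤ A * (1 + ‖ξ‖) ^ k

lemma polyGrowth_const (z : ℂ) : PolyGrowth (fun _ : E => z) :=
  ⟨continuous_const, ‖z‖, 0, fun ξ => by simp⟩

lemma PolyGrowth.mul {p q : E → ℂ} (hp : PolyGrowth p) (hq : PolyGrowth q) :
    PolyGrowth (fun ξ => p ξ * q ξ) := by
  obtain ⟨hp, A, k, hA⟩ := hp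
  obtain ⟨hq, B, l, hB⟩ := hq
  refine ⟨hp.mul hq, A * B, k + l, fun ξ => ?_⟩
  rw [norm_mul, pow_add]
  calc ‖p ξ‖ * ‖q ξ‖ ≤ (A * (1 + ‖ξ‖) ^ k) * (B * (1 + ‖ξ‖) ^ l) :=
        mul_le_mul (hA ξ) (hB ξ) (norm_nonneg _) ((norm_nonneg _).trans (hA ξ))
    _ = _ := by ring

lemma RapidDecay.mul (h : RapidDecay a b w) {c : ℝ → ℂ} (hc : Continuous c) {p : E → ℂ}
    (hp : PolyGrowth p) : RapidDecay a b (fun t ξ => c t * p ξ * w t ξ) := by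
  obtain ⟨hpc, A, k, hA⟩ := hp
  obtain ⟨K, hK⟩ := (isCompact_Icc (a := a) (b := b)).exists_bound_of_continuousOn hc.continuousOn
  refine ⟨?_, fun N => ?_⟩
  · refine ContinuousOn.mul ?_ h.1
    exact ((hc.comp continuous_fst).mul (hpc.comp continuous_snd)).continuousOn
  · obtain ⟨C, hC⟩ := h.2 (N + k)
    refine ⟨K * A * C, fun t ht ξ => ?_⟩
    have hA0 : 0 ≤ A := by
      have := (norm_nonneg _).trans (hA 0); simpa using this
    have hK0 : 0 ≤ K := (norm_nonneg _).trans (hK t ht)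
    rw [norm_mul, norm_mul]
    calc (1 + ‖ξ‖) ^ N * (‖c t‖ * ‖p ξ‖ * ‖w t ξ‖)
        ≤ (1 + ‖ξ‖) ^ N * (K * (A * (1 + ‖ξ‖) ^ k) * ‖w t ξ‖) := by
          gcongr
          · exact hK t ht
          · exact hA ξ
      _ = K * A * ((1 + ‖ξ‖) ^ (N + k) * ‖w t ξ‖) := by rw [pow_add]; ring
      _ ≤ K * A * C := by gcongr; exact hC t ht ξ

lemma RapidDecayDeriv.mul (h : RapidDecayDeriv a b n w) {c : ℝ → ℂ} (hc : ContDiff ℝ ∞ c)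
    {p : E → ℂ} (hp : PolyGrowth p) :
    RapidDecayDeriv a b n (fun t ξ => c t * p ξ * w t ξ) := by
  induction n generalizing w c with
  | zero => exact RapidDecay.mul h hc.continuous hp
  | succ n ih =>
    have hw := h.of_succ
    obtain ⟨h0, w', h1, h2⟩ := h
    refine ⟨h0.mul hc.continuous hp, _,
      (ih hw (contDiff_infty_iff_deriv.1 hc).2).add (ih h1 hc), fun ξ t ht => ?_⟩
    have := (((contDiff_infty_iff_deriv.1 hc).1 t).hasDerivAt.mul_const (p ξ)).mul (h2 ξ t ht)
    exact this

lemma RapidDecayDeriv.mul_poly (h : RapidDecayDeriv a b n w) {p : E → ℂ} (hp : PolyGrowth p) :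
    RapidDecayDeriv a b n (fun t ξ => p ξ * w t ξ) := by
  simpa using h.mul (c := fun _ => 1) contDiff_const hp

lemma RapidDecayDeriv.sum {ι : Type*} (s : Finset ι) {W : ι → ℝ → E → ℂ}
    (h : ∀ i ∈ s, RapidDecayDeriv a b n (W i)) :
    RapidDecayDeriv a b n (fun t ξ => ∑ i ∈ s, W i t ξ) := by
  classical
  induction s using Finset.induction_on with
  | empty =>
    simp only [Finset.sum_empty]
    clear h
    induction n with
    | zero => exact ⟨continuousOn_const, fun N => ⟨0, by simp⟩⟩
    | succ n ih =>
      exact ⟨ih.rapidDecay, _, ih, fun ξ t _ => hasDerivAt_const _ _⟩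
  | insert i s hi ih =>
    simp only [Finset.sum_insert hi]
    exact (h i (Finset.mem_insert_self _ _)).add
      (ih fun j hj => h j (Finset.mem_insert_of_mem hj))

lemma RapidDecay.continuous_apply (h : RapidDecay a b w) {t : ℝ} (ht : t ∈ Icc a b) :
    Continuous (w t) :=
  h.1.comp_continuous (f := fun ξ => (t, ξ)) (by fun_prop) fun _ => ⟨ht, mem_univ _⟩

/-- Regularity in `t` is gained from a second order equation in `t`. -/
lemma RapidDecay.of_second_deriv (hab : a < b) (hw : RapidDecay a b w)
    (h₂ : RapidDecayDeriv a b n w₂)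
    (hd : ∀ ξ, ∃ w' : ℝ → ℂ, (∀ t ∈ Ioo a b, HasDerivAt (fun s => w s ξ) (w' t) t) ∧
      ∀ t ∈ Ioo a b, HasDerivAt w' (w₂ t ξ) t) :
    RapidDecayDeriv a b (n + 2) w := by
  have hr := h₂.rapidDecay
  set W : ℝ → E → ℂ := fun t ξ => w₂ (projIcc a b hab.le t) ξ with hW
  have hWc : Continuous (fun x : E × ℝ => W x.2 x.1) := by
    refine hr.1.comp_continuous (f := fun x : E × ℝ => ((projIcc a b hab.le x.2 : ℝ), x.1))
      ?_ fun x => ⟨Subtype.prop _, mem_univ _⟩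
    exact ((continuous_subtype_val.comp continuous_projIcc).comp continuous_snd).prodMk
      continuous_fst
  have hWeq : ∀ t ∈ Icc a b, ∀ ξ, W t ξ = w₂ t ξ := fun t ht ξ => by
    simp only [hW, projIcc_of_mem hab.le ht]
  set P : ℝ → E → ℂ := fun t ξ => ∫ x in a..t, W x ξ with hP
  have hPc : Continuous (fun x : E × ℝ => P x.2 x.1) :=
    intervalIntegral.continuous_parametric_intervalIntegral_of_continuous
      (f := fun (x : E × ℝ) s => W s x.1) (s := fun x => x.2)
      (hWc.comp ((continuous_fst.comp continuous_fst).prodMk continuous_snd)) continuous_snd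
  set w' : ℝ → E → ℂ := fun t ξ =>
    (w b ξ - w a ξ - ∫ s in a..b, P s ξ) / (b - a) + P t ξ with hw'
  have hPR : Continuous (fun ξ : E => ∫ s in a..b, P s ξ) :=
    intervalIntegral.continuous_parametric_intervalIntegral_of_continuous'
      (f := fun ξ s => P s ξ) hPc a b
  have hend : ∀ t ∈ Icc a b, Continuous (w t) := fun t ht =>
    hw.1.comp_continuous (f := fun ξ => (t, ξ)) (by fun_prop) fun ξ => ⟨ht, mem_univ _⟩
  have hw'r : RapidDecay a b w' := by
    refine ⟨Continuous.continuousOn ?_, fun N => ?_⟩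
    · refine Continuous.add ?_ (hPc.comp continuous_swap)
      refine Continuous.div_const ?_ _
      exact (((hend b (right_mem_Icc.2 hab.le)).sub (hend a (left_mem_Icc.2 hab.le))).sub
        hPR).comp continuous_snd
    · obtain ⟨C, hC⟩ := hw.2 N
      obtain ⟨D, hD⟩ := hr.2 N
      refine ⟨(C + C + D * (b - a) * (b - a)) / (b - a) + D * (b - a), fun t ht ξ => ?_⟩
      set A : ℝ := (1 + ‖ξ‖) ^ N with hA
      have hA0 : 0 < A := by positivity
      have hba : 0 < b - a := sub_pos.2 hab
      have hP1 : ∀ s ∈ Icc a b, ‖P s ξ‖ ≤ D / A * (b - a) := by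
        intro s hs
        have h3 : ‖∫ x in a..s, W x ξ‖ ≤ D / A * |s - a| := by
          refine intervalIntegral.norm_integral_le_of_norm_le_const fun x hx => ?_
          rw [uIoc_of_le hs.1] at hx
          have hx' : x ∈ Icc a b := ⟨hx.1.le, hx.2.trans hs.2⟩
          rw [hWeq x hx', le_div_iff₀ hA0, mul_comm]
          exact hD x hx' ξ
        refine h3.trans ?_
        rw [abs_of_nonneg (sub_nonneg.2 hs.1)]
        have hD0 : 0 ≤ D := le_trans (by positivity) (hD t ht ξ)
        gcongr
        exact hs.2
      have hR1 : ‖∫ s in a..b, P s ξ‖ ≤ D / A * (b - a) * (b - a) := by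
        have h3 : ‖∫ s in a..b, P s ξ‖ ≤ D / A * (b - a) * |b - a| := by
          refine intervalIntegral.norm_integral_le_of_norm_le_const fun x hx => ?_
          rw [uIoc_of_le hab.le] at hx
          exact hP1 x ⟨hx.1.le, hx.2⟩
        rwa [abs_of_pos hba] at h3
      have hwe : ∀ s ∈ Icc a b, ‖w s ξ‖ ≤ C / A := fun s hs => by
        rw [le_div_iff₀ hA0, mul_comm]; exact hC s hs ξ
      have hnba : ‖((b : ℂ) - a)‖ = b - a := by
        rw [← Complex.ofReal_sub, Complex.norm_real, Real.norm_of_nonneg hba.le]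
      have : ‖w' t ξ‖ ≤ (C / A + C / A + D / A * (b - a) * (b - a)) / (b - a)
          + D / A * (b - a) := by
        refine (norm_add_le _ _).trans (add_le_add ?_ (hP1 t ht))
        rw [norm_div, hnba]
        gcongr
        refine (norm_sub_le _ _).trans (add_le_add ((norm_sub_le _ _).trans ?_) hR1)
        exact add_le_add (hwe b (right_mem_Icc.2 hab.le)) (hwe a (left_mem_Icc.2 hab.le))
      calc A * ‖w' t ξ‖ ≤ A * ((C / A + C / A + D / A * (b - a) * (b - a)) / (b - a)
          + D / A * (b - a)) := by gcongr
        _ = _ := by field_simp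
  have hderiv : ∀ ξ, (∀ t ∈ Ioo a b, HasDerivAt (fun s => w s ξ) (w' t ξ) t) ∧
      ∀ t ∈ Ioo a b, HasDerivAt (fun s => w' s ξ) (w₂ t ξ) t := by
    intro ξ
    obtain ⟨v, hv1, hv2⟩ := hd ξ
    have hWξ : Continuous (fun t => W t ξ) := hWc.comp (by fun_prop : Continuous fun t => (ξ, t))
    have hv : ∀ t ∈ Ioo a b, v t = w' t ξ :=
      deriv_eq_slope_add_primitive hab
        (hw.1.comp (f := fun t => (t, ξ)) (by fun_prop) fun t ht => ⟨ht, mem_univ _⟩) hWξ hv1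
        (fun t ht => by rw [hWeq t (Ioo_subset_Icc_self ht)]; exact hv2 t ht)
    refine ⟨fun t ht => hv t ht ▸ hv1 t ht, fun t ht => (hv2 t ht).congr_of_eventuallyEq ?_⟩
    filter_upwards [Ioo_mem_nhds ht.1 ht.2] with s hs using (hv s hs).symm
  exact ⟨hw, w', ⟨hw'r, w₂, h₂, fun ξ => (hderiv ξ).2⟩, fun ξ => (hderiv ξ).1⟩

variable [InnerProductSpace ℝ E]

lemma polyGrowth_inner (η : E) : PolyGrowth (fun ξ : E => ((inner ℝ ξ η : ℝ) : ℂ)) := by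
  refine ⟨by fun_prop, ‖η‖, 1, fun ξ => ?_⟩
  rw [Complex.norm_real]
  refine (norm_inner_le_norm _ _).trans ?_
  nlinarith [norm_nonneg ξ, norm_nonneg η]

/-- The character `y ↦ exp (2 π i ⟨ξ, y⟩)`. -/
def expInner (ξ y : E) : ℂ := Complex.exp (((2 * Real.pi * inner ℝ ξ y : ℝ) : ℂ) * Complex.I)

lemma norm_expInner (ξ y : E) : ‖expInner ξ y‖ = 1 := Complex.norm_exp_ofReal_mul_I _

@[fun_prop]
lemma continuous_expInner : Continuous (fun x : E × E => expInner x.1 x.2) := by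
  unfold expInner; fun_prop

lemma hasFDerivAt_expInner (ξ y : E) :
    HasFDerivAt (expInner ξ) ((2 * Real.pi * Complex.I * expInner ξ y) •
      (Complex.ofRealCLM.comp (innerSL ℝ ξ))) y := by
  have h1 : HasFDerivAt (fun y => ((2 * Real.pi * inner ℝ ξ y : ℝ) : ℂ) * Complex.I)
      ((2 * Real.pi * Complex.I) • (Complex.ofRealCLM.comp (innerSL ℝ ξ))) y := by
    have := ((Complex.ofRealCLM.comp (innerSL ℝ ξ)).hasFDerivAt (x := y)).const_mul
      (2 * Real.pi * Complex.I)
    refine this.congr_of_eventuallyEq (Eventually.of_forall fun z => ?_)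
    simp; ring
  refine h1.cexp.congr_fderiv ?_
  ext z
  simp [expInner]; ring

variable [FiniteDimensional ℝ E] [MeasurableSpace E] [BorelSpace E]

lemma RapidDecay.exists_integrable_bound (h : RapidDecay a b w) :
    ∃ g : E → ℝ, Integrable g ∧ ∀ t ∈ Icc a b, ∀ ξ, (1 + ‖ξ‖) * ‖w t ξ‖ ≤ g ξ := by
  set d := Module.finrank ℝ E
  obtain ⟨C, hC⟩ := h.2 (d + 2)
  refine ⟨fun ξ => C * (1 + ‖ξ‖) ^ (-((d : ℝ) + 1)),
    (integrable_one_add_norm (by linarith)).const_mul C, fun t ht ξ => ?_⟩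
  have h0 : 0 < 1 + ‖ξ‖ := by positivity
  have : (1 + ‖ξ‖) ^ (-((d : ℝ) + 1)) = ((1 + ‖ξ‖) ^ (d + 1))⁻¹ := by
    rw [Real.rpow_neg h0.le, ← Real.rpow_natCast]; norm_num
  simp only [this]
  rw [← div_eq_mul_inv, le_div_iff₀ (by positivity)]
  calc _ = (1 + ‖ξ‖) ^ (d + 2) * ‖w t ξ‖ := by ring
    _ ≤ C := hC t ht ξ

lemma RapidDecay.continuousOn_integral (h : RapidDecay a b w) :
    ContinuousOn (fun x : ℝ × E => ∫ ξ, expInner ξ x.2 * w x.1 ξ) (Icc a b ×ˢ univ) := by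
  obtain ⟨g, hg, hb⟩ := h.exists_integrable_bound
  refine continuousOn_of_dominated (bound := g) (fun x hx => ?_) (fun x hx => ?_) hg ?_
  · refine Continuous.aestronglyMeasurable (Continuous.mul ?_ (h.continuous_apply hx.1))
    exact continuous_expInner.comp (by fun_prop : Continuous fun ξ => (ξ, x.2))
  · refine Eventually.of_forall fun ξ => ?_
    rw [norm_mul, norm_expInner, one_mul]
    refine le_trans ?_ (hb x.1 hx.1 ξ)
    nlinarith [norm_nonneg ξ, norm_nonneg (w x.1 ξ)]
  · refine Eventually.of_forall fun ξ => ContinuousOn.mul ?_ ?_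
    · exact (continuous_expInner.comp
        (by fun_prop : Continuous fun x : ℝ × E => (ξ, x.2))).continuousOn
    · exact h.1.comp (f := fun x : ℝ × E => (x.1, ξ)) (by fun_prop) fun x hx => ⟨hx.1, mem_univ _⟩

set_option maxSynthPendingDepth 5 in
/-- Fourier synthesis of a symbol which, with its derivatives in `t`, decays rapidly, is smooth up
to the boundary of the strip. -/
lemma RapidDecayDeriv.contDiffOn_integral (hab : a < b) (h : RapidDecayDeriv a b n w) :
    ContDiffOn ℝ n (fun x : ℝ × E => ∫ ξ, expInner ξ x.2 * w x.1 ξ) (Icc a b ×ˢ univ) := by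
  induction n generalizing w with
  | zero => exact contDiffOn_zero.2 h.rapidDecay.continuousOn_integral
  | succ n ih =>
    have hwn := h.of_succ
    obtain ⟨h0, w', h1, hd⟩ := h
    have h1r := h1.rapidDecay
    set F' : ℝ × E → E → (ℝ × E →L[ℝ] ℂ) := fun x ξ =>
      (expInner ξ x.2 * w' x.1 ξ) •
          (Complex.ofRealCLM.comp (ContinuousLinearMap.fst ℝ ℝ E)) +
        (2 * Real.pi * Complex.I * expInner ξ x.2 * w x.1 ξ) •
          ((Complex.ofRealCLM.comp (innerSL ℝ ξ)).comp (ContinuousLinearMap.snd ℝ ℝ E)) with hF'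
    obtain ⟨g, hg, hgb⟩ := h0.exists_integrable_bound
    obtain ⟨g', hg', hgb'⟩ := h1r.exists_integrable_bound
    have hbound : ∀ x ∈ Icc a b ×ˢ (univ : Set E), ∀ ξ,
        ‖F' x ξ‖ ≤ g' ξ + 2 * Real.pi * g ξ := by
      intro x hx ξ
      refine (norm_add_le _ _).trans (add_le_add ?_ ?_)
      · rw [norm_smul, norm_mul, norm_expInner, one_mul]
        have e1 : ‖Complex.ofRealCLM.comp (ContinuousLinearMap.fst ℝ ℝ E)‖ ≤ 1 := by
          refine (ContinuousLinearMap.opNorm_comp_le _ _).trans ?_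
          rw [Complex.ofRealCLM_norm, one_mul]
          exact ContinuousLinearMap.norm_fst_le ℝ ℝ E
        have e2 := hgb' x.1 hx.1 ξ
        nlinarith [norm_nonneg ξ, norm_nonneg (w' x.1 ξ)]
      · have e1 : ‖(Complex.ofRealCLM.comp (innerSL ℝ ξ)).comp
            (ContinuousLinearMap.snd ℝ ℝ E)‖ ≤ ‖ξ‖ := by
          refine (ContinuousLinearMap.opNorm_comp_le _ _).trans ?_
          have e3 : ‖Complex.ofRealCLM.comp (innerSL ℝ ξ)‖ ≤ ‖ξ‖ := by
            refine (ContinuousLinearMap.opNorm_comp_le _ _).trans ?_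
            rw [Complex.ofRealCLM_norm, one_mul, innerSL_apply_norm]
          calc _ ≤ ‖ξ‖ * 1 := by
                gcongr
                exact ContinuousLinearMap.norm_snd_le ℝ ℝ E
            _ = ‖ξ‖ := mul_one _
        have e2 := hgb x.1 hx.1 ξ
        have e4 : ‖(2 * Real.pi * Complex.I * expInner ξ x.2 * w x.1 ξ : ℂ)‖
            = 2 * Real.pi * ‖w x.1 ξ‖ := by
          simp [norm_expInner, abs_of_pos Real.pi_pos]
        rw [norm_smul, e4, mul_assoc]
        gcongr
        calc ‖w x.1 ξ‖ * _ ≤ ‖w x.1 ξ‖ * ‖ξ‖ := by gcongr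
          _ ≤ g ξ := by nlinarith [norm_nonneg ξ, norm_nonneg (w x.1 ξ)]
    have hF'c : ∀ x ∈ Icc a b ×ˢ (univ : Set E), Continuous (F' x) := by
      intro x hx
      have c1 : Continuous fun ξ => expInner ξ x.2 :=
        continuous_expInner.comp (by fun_prop : Continuous fun ξ => (ξ, x.2))
      have c2 := h1r.continuous_apply hx.1
      have c3 := h0.continuous_apply hx.1
      have c4 : Continuous fun ξ : E => (Complex.ofRealCLM.comp (innerSL ℝ ξ)).comp
          (ContinuousLinearMap.snd ℝ ℝ E) :=
        (continuous_const.clm_comp (innerSL ℝ (E := E)).continuous).clm_comp continuous_const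
      exact ((c1.mul c2).smul continuous_const).add (((continuous_const.mul c1).mul c3).smul c4)
    have hbi : Integrable (fun ξ => g' ξ + 2 * Real.pi * g ξ) := hg'.add (hg.const_mul _)
    have hF'i : ∀ x ∈ Icc a b ×ˢ (univ : Set E), Integrable (F' x) := fun x hx =>
      hbi.mono' (hF'c x hx).aestronglyMeasurable (Eventually.of_forall (hbound x hx))
    set D : ℝ × E → (ℝ × E →L[ℝ] ℂ) := fun x => ∫ ξ, F' x ξ with hD
    have hDsmooth : ContDiffOn ℝ n D (Icc a b ×ˢ univ) := by
      refine contDiffOn_clm_apply.2 fun ⟨s, η⟩ => ?_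
      have hw2 : RapidDecayDeriv a b n
          (fun t ξ => (s : ℂ) * w' t ξ +
            (2 * Real.pi * Complex.I * ((inner ℝ ξ η : ℝ) : ℂ)) * w t ξ) :=
        (h1.mul_poly (polyGrowth_const _)).add
          (hwn.mul_poly ((polyGrowth_const _).mul (polyGrowth_inner η)))
      refine (ih hw2).congr fun x hx => ?_
      rw [hD]
      simp only
      rw [ContinuousLinearMap.integral_apply (hF'i x hx)]
      refine integral_congr_ae (Eventually.of_forall fun ξ => ?_)
      simp [hF']; ring
    have hder : ∀ x ∈ Ioo a b ×ˢ (univ : Set E),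
        HasFDerivAt (fun x : ℝ × E => ∫ ξ, expInner ξ x.2 * w x.1 ξ) (D x) x := by
      intro x hx
      have hsub : Ioo a b ×ˢ (univ : Set E) ⊆ Icc a b ×ˢ univ :=
        prod_mono Ioo_subset_Icc_self le_rfl
      have hnx : Ioo a b ×ˢ (univ : Set E) ∈ 𝓝 x := (isOpen_Ioo.prod isOpen_univ).mem_nhds hx
      have hmeas : ∀ x ∈ Ioo a b ×ˢ (univ : Set E),
          Continuous (fun ξ => expInner ξ x.2 * w x.1 ξ) := fun x hx =>
        (continuous_expInner.comp (by fun_prop : Continuous fun ξ => (ξ, x.2))).mul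
          (h0.continuous_apply (hsub hx).1)
      refine hasFDerivAt_integral_of_dominated_of_fderiv_le (𝕜 := ℝ)
        (F := fun (x : ℝ × E) ξ => expInner ξ x.2 * w x.1 ξ) (F' := F') hnx ?_ ?_
        (hF'c x (hsub hx)).aestronglyMeasurable
        (Eventually.of_forall fun ξ y hy => hbound y (hsub hy) ξ) hbi
        (Eventually.of_forall fun ξ y hy => ?_)
      · filter_upwards [hnx] with y hy using (hmeas y hy).aestronglyMeasurable
      · refine hg.mono' (hmeas x hx).aestronglyMeasurable (Eventually.of_forall fun ξ => ?_)
        rw [norm_mul, norm_expInner, one_mul]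
        refine le_trans ?_ (hgb x.1 (hsub hx).1 ξ)
        nlinarith [norm_nonneg ξ, norm_nonneg (w x.1 ξ)]
      · have d1 : HasFDerivAt (fun y : ℝ × E => expInner ξ y.2) _ y :=
          (hasFDerivAt_expInner ξ y.2).comp y hasFDerivAt_snd
        have d2 : HasFDerivAt (fun y : ℝ × E => w y.1 ξ) _ y :=
          (hd ξ y.1 hy.1).hasFDerivAt.comp y hasFDerivAt_fst
        refine (d1.mul d2).congr_fderiv ?_
        ext z
        · simp [hF']
        · simp [hF']; ring
    refine (contDiffOn_succ_iff_hasFDerivWithinAt_of_uniqueDiffOn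
      ((uniqueDiffOn_Icc hab).prod uniqueDiffOn_univ)).2 ⟨by simp, D, hDsmooth, fun x hx => ?_⟩
    have hcl : closure (Ioo a b ×ˢ (univ : Set E)) = Icc a b ×ˢ univ := by
      rw [closure_prod_eq, closure_Ioo hab.ne, closure_univ]
    rw [← hcl]
    refine hasFDerivWithinAt_closure_of_tendsto_fderiv
      (fun y hy => (hder y hy).differentiableAt.differentiableWithinAt)
      ((convex_Ioo a b).prod convex_univ) (isOpen_Ioo.prod isOpen_univ) (fun y hy => ?_) ?_
    · rw [hcl] at hy
      exact (h0.continuousOn_integral y hy).mono (prod_mono Ioo_subset_Icc_self le_rfl)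
    · refine Tendsto.congr' ?_ ((hDsmooth.continuousOn x hx).mono
        (prod_mono (s₁ := Ioo a b) Ioo_subset_Icc_self le_rfl))
      filter_upwards [self_mem_nhdsWithin] with y hy using (hder y hy).fderiv.symm

end Synthesis

lemma continuousOn_slice {E : Type*} [TopologicalSpace E] {B : Set E} {S : Set ℝ} {f : ℝ × E → ℂ}
    (hf : ContinuousOn f (S ×ˢ B)) {t : ℝ}
    (ht : t ∈ S) : ContinuousOn (fun y => f (t, y)) B :=
  hf.comp (by fun_prop) fun _ hy => ⟨ht, hy⟩

section LocalFourier

variable {E : Type*} [NormedAddCommGroup E] [InnerProductSpace ℝ E]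

/-- Smooth functions with compact support in `B`. -/
structure IsCutoff (B : Set E) (χ : E → ℂ) : Prop where
  smooth : ContDiff ℝ ∞ χ
  compact : HasCompactSupport χ
  subset : tsupport χ ⊆ B

variable {B : Set E} {χ h h' : E → ℂ}

lemma IsCutoff.eq_zero (hχ : IsCutoff B χ) {y : E} (hy : y ∉ B) : χ y = 0 :=
  image_eq_zero_of_notMem_tsupport fun h => hy (hχ.subset h)

lemma IsCutoff.fderiv_apply (hχ : IsCutoff B χ) (η : E) :
    IsCutoff B (fun y => fderiv ℝ χ y η) := by
  refine ⟨(hχ.smooth.fderiv_right (m := ∞) (by simp)).clm_apply contDiff_const,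
    hχ.compact.fderiv_apply ℝ η, ?_⟩
  exact (tsupport_fderiv_apply_subset ℝ η).trans hχ.subset

lemma IsCutoff.mul_continuous (hχ : IsCutoff B χ) (hB : IsOpen B) (hh : ContinuousOn h B) :
    Continuous (fun y => χ y * h y) := by
  refine continuous_of_tsupport fun y hy => ?_
  exact hχ.smooth.continuous.continuousAt.mul
    (hh.continuousAt (hB.mem_nhds (hχ.subset (tsupport_mul_subset_left hy))))

lemma IsCutoff.mul_hasCompactSupport (hχ : IsCutoff B χ) (h : E → ℂ) :
    HasCompactSupport (fun y => χ y * h y) :=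
  hχ.compact.mul_right

lemma IsCutoff.mul_contDiff (hχ : IsCutoff B χ) (hB : IsOpen B) (hh : ContDiffOn ℝ 1 h B) :
    ContDiff ℝ 1 (fun y => χ y * h y) := by
  refine contDiff_iff_contDiffAt.2 fun y => ?_
  by_cases hy : y ∈ tsupport χ
  · exact (hχ.smooth.of_le (by norm_cast)).contDiffAt.mul
      (hh.contDiffAt (hB.mem_nhds (hχ.subset hy)))
  · refine (contDiffAt_const (c := (0 : ℂ))).congr_of_eventuallyEq ?_
    filter_upwards [notMem_tsupport_iff_eventuallyEq.1 hy] with z hz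
    simp [hz]

variable [FiniteDimensional ℝ E] [MeasurableSpace E] [BorelSpace E]

lemma IsCutoff.mul_integrable (hχ : IsCutoff B χ) (hB : IsOpen B) (hh : ContinuousOn h B) :
    Integrable (fun y => χ y * h y) :=
  (hχ.mul_continuous hB hh).integrable_of_hasCompactSupport (hχ.mul_hasCompactSupport h)

lemma fourier_fderiv_apply {f : E → ℂ} (hf : ContDiff ℝ 1 f) (hc : HasCompactSupport f)
    (η ξ : E) : 𝓕 (fun y => fderiv ℝ f y η) ξ =
      2 * Real.pi * Complex.I * (inner ℝ ξ η : ℝ) * 𝓕 f ξ := by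
  have hi : Integrable (fderiv ℝ f) :=
    (hf.continuous_fderiv (by simp)).integrable_of_hasCompactSupport (hc.fderiv ℝ)
  have h1 := Real.fourier_fderiv (hf.continuous.integrable_of_hasCompactSupport hc)
    (hf.differentiable (by simp)) hi
  have h2 := Real.fourier_continuousLinearMap_apply (v := ξ) (a := η) hi
  rw [h2.symm, h1]
  simp [VectorFourier.fourierSMulRight]
  rw [innerSL_apply_apply]
  ring

lemma IsCutoff.fourier_mul_fderiv (hχ : IsCutoff B χ) (hB : IsOpen B) (hh : ContDiffOn ℝ 1 h B)
    {η : E} (hd : ∀ y ∈ B, fderiv ℝ h y η = h' y) (ξ : E) :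
    𝓕 (fun y => χ y * h' y) ξ =
      2 * Real.pi * Complex.I * (inner ℝ ξ η : ℝ) * 𝓕 (fun y => χ y * h y) ξ
        - 𝓕 (fun y => fderiv ℝ χ y η * h y) ξ := by
  have hh' : ContinuousOn h' B :=
    ((hh.continuousOn_fderiv_of_isOpen hB le_rfl).clm_apply continuousOn_const).congr
      fun y hy => (hd y hy).symm
  rw [← fourier_fderiv_apply (hχ.mul_contDiff hB hh) (hχ.mul_hasCompactSupport h),
    eq_sub_iff_add_eq, ← Pi.add_apply]
  have hadd := VectorFourier.fourierIntegral_add (μ := volume) Real.continuous_fourierChar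
    (L := innerₗ E) continuous_inner (hχ.mul_integrable hB hh')
    ((hχ.fderiv_apply η).mul_integrable hB hh.continuousOn)
  refine (congrFun hadd ξ).symm.trans ?_
  refine congrArg (fun f : E → ℂ => 𝓕 f ξ) ?_
  ext y
  by_cases hy : y ∈ B
  · have h1 : DifferentiableAt ℝ χ y := hχ.smooth.differentiable (by simp) y
    have h2 : DifferentiableAt ℝ h y := (hh.contDiffAt (hB.mem_nhds hy)).differentiableAt (by simp)
    rw [fderiv_fun_mul h1 h2]
    simp [← hd y hy]
    ring
  · have h0 : (fun y => χ y * h y) =ᶠ[𝓝 y] fun _ => 0 := by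
      have : y ∉ tsupport χ := fun h => hy (hχ.subset h)
      filter_upwards [notMem_tsupport_iff_eventuallyEq.1 this] with z hz
      simp [hz]
    rw [h0.fderiv_eq]
    simp [hχ.eq_zero hy, (hχ.fderiv_apply η).eq_zero hy]

/-- The Fourier transform in the second variable of a function localised by `χ`. -/
def locFourier (χ : E → ℂ) (f : ℝ × E → ℂ) (t : ℝ) (ξ : E) : ℂ := 𝓕 (fun y => χ y * f (t, y)) ξ

lemma locFourier_eq (χ : E → ℂ) (f : ℝ × E → ℂ) (t : ℝ) (ξ : E) :
    locFourier χ f t ξ = ∫ y, expInner y (-ξ) * (χ y * f (t, y)) := by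
  rw [locFourier, Real.fourier_eq']
  simp [expInner]

variable {f ft : ℝ × E → ℂ}

lemma IsCutoff.exists_bound (hχ : IsCutoff B χ) {S : Set ℝ} (hS : IsCompact S)
    (hf : ContinuousOn f (S ×ˢ B)) :
    ∃ g : E → ℝ, Integrable g ∧ ∀ t ∈ S, ∀ ξ y, ‖expInner y (-ξ) * (χ y * f (t, y))‖ ≤ g y := by
  obtain ⟨C, hC⟩ := (hS.prod hχ.compact.isCompact).exists_bound_of_continuousOn
    (hf.mono (prod_mono_right hχ.subset))
  refine ⟨fun y => ‖χ y‖ * C, ((hχ.smooth.continuous.integrable_of_hasCompactSupport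
    hχ.compact).norm).mul_const C, fun t ht ξ y => ?_⟩
  rw [norm_mul, norm_expInner, one_mul, norm_mul]
  by_cases hy : y ∈ tsupport χ
  · exact mul_le_mul_of_nonneg_left (hC (t, y) ⟨ht, hy⟩) (norm_nonneg _)
  · simp [image_eq_zero_of_notMem_tsupport hy]

lemma IsCutoff.locFourier_bounded (hχ : IsCutoff B χ) {S : Set ℝ} (hS : IsCompact S)
    (hf : ContinuousOn f (S ×ˢ B)) : ∃ C, ∀ t ∈ S, ∀ ξ, ‖locFourier χ f t ξ‖ ≤ C := by
  obtain ⟨g, hg, hb⟩ := hχ.exists_bound hS hf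
  refine ⟨∫ y, g y, fun t ht ξ => ?_⟩
  rw [locFourier_eq]
  exact norm_integral_le_of_norm_le hg (Eventually.of_forall (hb t ht ξ))

lemma IsCutoff.aestronglyMeasurable (hχ : IsCutoff B χ) (hB : IsOpen B) (hh : ContinuousOn h B)
    (ξ : E) : AEStronglyMeasurable (fun y => expInner y (-ξ) * (χ y * h y)) :=
  (Continuous.mul (by fun_prop) (hχ.mul_continuous hB hh)).aestronglyMeasurable

lemma IsCutoff.locFourier_continuousOn (hχ : IsCutoff B χ) (hB : IsOpen B) {S : Set ℝ}
    (hS : IsCompact S) (hf : ContinuousOn f (S ×ˢ B)) :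
    ContinuousOn (fun x : ℝ × E => locFourier χ f x.1 x.2) (S ×ˢ univ) := by
  obtain ⟨g, hg, hb⟩ := hχ.exists_bound hS hf
  simp only [locFourier_eq]
  refine continuousOn_of_dominated (bound := g)
    (fun x hx => hχ.aestronglyMeasurable hB (continuousOn_slice hf hx.1) _)
    (fun x hx => Eventually.of_forall fun y => hb x.1 hx.1 x.2 y) hg
    (Eventually.of_forall fun y => ?_)
  by_cases hy : y ∈ B
  · have : ContinuousOn (fun x : ℝ × E => f (x.1, y)) (S ×ˢ univ) :=
      hf.comp (by fun_prop) fun x hx => ⟨hx.1, hy⟩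
    exact (Continuous.continuousOn (continuous_expInner.comp
      (continuous_const.prodMk continuous_snd.neg))).mul (continuousOn_const.mul this)
  · simp only [hχ.eq_zero hy, zero_mul, mul_zero]
    exact continuousOn_const

lemma IsCutoff.hasDerivAt_locFourier (hχ : IsCutoff B χ) (hB : IsOpen B) {a b t : ℝ}
    (ht : t ∈ Ioo a b) (hf : ContinuousOn f (Ioo a b ×ˢ B)) (hft : ContinuousOn ft (Ioo a b ×ˢ B))
    (hd : ∀ y ∈ B, ∀ s ∈ Ioo a b, HasDerivAt (fun s => f (s, y)) (ft (s, y)) s) (ξ : E) :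
    HasDerivAt (fun s => locFourier χ f s ξ) (locFourier χ ft t ξ) t := by
  obtain ⟨ε, hε, hsub⟩ := Metric.nhds_basis_closedBall.mem_iff.1 (isOpen_Ioo.mem_nhds ht)
  obtain ⟨g, hg, hb⟩ := hχ.exists_bound (isCompact_closedBall t ε)
    (hft.mono (prod_mono_left hsub))
  obtain ⟨g₀, hg₀, hb₀⟩ := hχ.exists_bound (isCompact_closedBall t ε)
    (hf.mono (prod_mono_left hsub))
  simp only [locFourier_eq]
  refine (hasDerivAt_integral_of_dominated_loc_of_deriv_le (bound := g)
    (F' := fun s y => expInner y (-ξ) * (χ y * ft (s, y)))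
    (Metric.closedBall_mem_nhds t hε) ?_ ?_ ?_ ?_ hg ?_).2
  · filter_upwards [Metric.closedBall_mem_nhds t hε] with s hs
      using hχ.aestronglyMeasurable hB (continuousOn_slice hf (hsub hs)) ξ
  · exact hg₀.mono' (hχ.aestronglyMeasurable hB (continuousOn_slice hf ht) ξ)
      (Eventually.of_forall (hb₀ t (Metric.mem_closedBall_self hε.le) ξ))
  · exact hχ.aestronglyMeasurable hB (continuousOn_slice hft ht) ξ
  · exact Eventually.of_forall fun y s hs => hb s hs ξ y
  · refine Eventually.of_forall fun y s hs => ?_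
    by_cases hy : y ∈ B
    · exact ((hd y hy s (hsub hs)).const_mul _).const_mul _
    · simp only [hχ.eq_zero hy, zero_mul, mul_zero]
      exact hasDerivAt_const _ _

end LocalFourier

lemma OrthonormalBasis.norm_le_sum_abs_inner {E : Type*} [NormedAddCommGroup E] [InnerProductSpace ℝ E]
    {ι : Type*} [Fintype ι] (e : OrthonormalBasis ι ℝ E) (ξ : E) :
    ‖ξ‖ ≤ ∑ j, |inner ℝ ξ (e j)| := by
  conv_lhs => rw [← e.sum_repr' ξ]
  refine (norm_sum_le _ _).trans (le_of_eq (Finset.sum_congr rfl fun j _ => ?_))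
  rw [norm_smul, e.norm_eq_one, mul_one, Real.norm_eq_abs, real_inner_comm]

section Strip

variable {E : Type*} [NormedAddCommGroup E] [NormedSpace ℝ E] {B : Set E} {S : Set ℝ}
  {f : ℝ × E → ℂ} {t : ℝ} {y : E} {n : WithTop ℕ∞}

lemma ContDiffOn.slice (hf : ContDiffOn ℝ n f (S ×ˢ B)) (ht : t ∈ S) :
    ContDiffOn ℝ n (fun y => f (t, y)) B :=
  hf.comp (contDiff_prodMk_right t).contDiffOn fun _ hy => ⟨ht, hy⟩

lemma fderiv_slice (hf : DifferentiableWithinAt ℝ f (S ×ˢ B) (t, y)) (hB : IsOpen B) (ht : t ∈ S)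
    (hy : y ∈ B) (η : E) :
    fderiv ℝ (fun y => f (t, y)) y η = fderivWithin ℝ f (S ×ˢ B) (t, y) (0, η) := by
  have h1 := (hf.hasFDerivWithinAt.comp y (hasFDerivAt_prodMk_right t y).hasFDerivWithinAt
    (fun z hz => ⟨ht, hz⟩ : MapsTo (fun z => (t, z)) B (S ×ˢ B))).hasFDerivAt (hB.mem_nhds hy)
  have h2 := h1.fderiv
  simp only [Function.comp_def] at h2
  rw [h2]
  simp

lemma hasDerivAt_slice (hf : DifferentiableWithinAt ℝ f (S ×ˢ B) (t, y)) (ht : S ∈ 𝓝 t)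
    (hy : y ∈ B) :
    HasDerivAt (fun s => f (s, y)) (fderivWithin ℝ f (S ×ˢ B) (t, y) (1, 0)) t := by
  have h0 : HasFDerivWithinAt (fun s : ℝ => (s, y)) (ContinuousLinearMap.inl ℝ ℝ E) S t :=
    (hasFDerivAt_prodMk_left t y).hasFDerivWithinAt
  have hm : MapsTo (fun s : ℝ => (s, y)) S (S ×ˢ B) := fun z hz => ⟨hz, hy⟩
  have h1 := (hf.hasFDerivWithinAt.comp t h0 hm).hasFDerivAt ht
  simpa [Function.comp_def] using h1.hasDerivAt

lemma ContDiffOn.fderivWithin_apply {s : Set (ℝ × E)} {m : WithTop ℕ∞} (hf : ContDiffOn ℝ n f s)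
    (hs : UniqueDiffOn ℝ s) (hmn : m + 1 ≤ n) (η : ℝ × E) :
    ContDiffOn ℝ m (fun x => fderivWithin ℝ f s x η) s :=
  (hf.fderivWithin hs hmn).clm_apply contDiffOn_const

end Strip

section Smooth

variable {E : Type*} [NormedAddCommGroup E] [InnerProductSpace ℝ E] [FiniteDimensional ℝ E]
  [MeasurableSpace E] [BorelSpace E] {ι : Type*} [Fintype ι] {B : Set E} {χ : E → ℂ}
  {f : ℝ × E → ℂ} {a b : ℝ}

lemma IsCutoff.norm_mul_locFourier_le (e : OrthonormalBasis ι ℝ E) (hχ : IsCutoff B χ)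
    (hB : IsOpen B) {S : Set ℝ} (hf : ContDiffOn ℝ 1 f (S ×ˢ B)) {t : ℝ} (ht : t ∈ S) (ξ : E) :
    ‖ξ‖ * ‖locFourier χ f t ξ‖ ≤
      ∑ j, (‖locFourier χ (fun x => fderivWithin ℝ f (S ×ˢ B) x (0, e j)) t ξ‖
        + ‖locFourier (fun y => fderiv ℝ χ y (e j)) f t ξ‖) := by
  refine (mul_le_mul_of_nonneg_right (e.norm_le_sum_abs_inner ξ) (norm_nonneg _)).trans ?_
  rw [Finset.sum_mul]
  refine Finset.sum_le_sum fun j _ => ?_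
  have h1 := hχ.fourier_mul_fderiv hB (hf.slice ht) (η := e j)
    (h' := fun y => fderivWithin ℝ f (S ×ˢ B) (t, y) (0, e j))
    (fun y hy => fderiv_slice (hf.differentiableOn (by simp) _ ⟨ht, hy⟩) hB ht hy _) ξ
  have h2 : 2 * Real.pi * Complex.I * (inner ℝ ξ (e j) : ℝ) * locFourier χ f t ξ =
      locFourier χ (fun x => fderivWithin ℝ f (S ×ˢ B) x (0, e j)) t ξ +
        locFourier (fun y => fderiv ℝ χ y (e j)) f t ξ := by
    unfold locFourier
    rw [h1]; ring
  refine le_trans ?_ (norm_add_le _ _)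
  rw [← h2]
  simp only [norm_mul, Complex.norm_I, Complex.norm_real, Real.norm_eq_abs, Complex.norm_ofNat,
    mul_one, abs_of_pos Real.pi_pos]
  have := Real.pi_gt_three
  have h3 : 0 ≤ |inner ℝ ξ (e j)| * ‖locFourier χ f t ξ‖ := by positivity
  nlinarith

lemma IsCutoff.locFourier_decay (hab : a < b) (hχ : IsCutoff B χ)
    (hB : IsOpen B) (hf : ContDiffOn ℝ ∞ f (Icc a b ×ˢ B)) (N : ℕ) :
    ∃ C : ℝ, ∀ t ∈ Icc a b, ∀ ξ, (1 + ‖ξ‖) ^ N * ‖locFourier χ f t ξ‖ ≤ C := by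
  induction N generalizing χ f with
  | zero => simpa using hχ.locFourier_bounded isCompact_Icc hf.continuousOn
  | succ N ih =>
    have e := stdOrthonormalBasis ℝ E
    have hU : UniqueDiffOn ℝ (Icc a b ×ˢ B) := (uniqueDiffOn_Icc hab).prod hB.uniqueDiffOn
    obtain ⟨C₀, hC₀⟩ := ih hχ hf
    choose C₁ hC₁ using fun j => ih hχ (hf.fderivWithin_apply hU (by simp) (0, e j))
    choose C₂ hC₂ using fun j => ih (hχ.fderiv_apply (e j)) hf
    refine ⟨C₀ + ∑ j, (C₁ j + C₂ j), fun t ht ξ => ?_⟩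
    have h1 := hχ.norm_mul_locFourier_le e hB (hf.of_le (by norm_cast)) ht ξ
    have h2 := mul_le_mul_of_nonneg_left h1 (by positivity : 0 ≤ (1 + ‖ξ‖) ^ N)
    rw [Finset.mul_sum] at h2
    have h3 := h2.trans (Finset.sum_le_sum fun j _ =>
      (mul_add ((1 + ‖ξ‖) ^ N) _ _).le.trans (add_le_add (hC₁ j t ht ξ) (hC₂ j t ht ξ)))
    have h4 := hC₀ t ht ξ
    rw [pow_succ]
    linarith

lemma IsCutoff.rapidDecayDeriv_locFourier (hab : a < b) (hχ : IsCutoff B χ) (hB : IsOpen B)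
    (hf : ContDiffOn ℝ ∞ f (Icc a b ×ˢ B)) (n : ℕ) : RapidDecayDeriv a b n (locFourier χ f) := by
  have hr {f : ℝ × E → ℂ} (hf : ContDiffOn ℝ ∞ f (Icc a b ×ˢ B)) :
      RapidDecay a b (locFourier χ f) :=
    ⟨hχ.locFourier_continuousOn hB isCompact_Icc hf.continuousOn,
      hχ.locFourier_decay hab hB hf⟩
  have hU : UniqueDiffOn ℝ (Icc a b ×ˢ B) := (uniqueDiffOn_Icc hab).prod hB.uniqueDiffOn
  have hsub : Ioo a b ×ˢ B ⊆ Icc a b ×ˢ B := prod_mono_left Ioo_subset_Icc_self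
  induction n generalizing f with
  | zero => exact hr hf
  | succ n ih =>
    have hf' := hf.fderivWithin_apply hU (m := ∞) (by simp) (1, 0)
    refine ⟨hr hf, _, ih hf', fun ξ t ht => hχ.hasDerivAt_locFourier hB ht
      (hf.continuousOn.mono hsub) (hf'.continuousOn.mono hsub) (fun y hy s hs => ?_) ξ⟩
    exact hasDerivAt_slice (hf.differentiableOn (by simp) _ ⟨Ioo_subset_Icc_self hs, hy⟩)
      (Icc_mem_nhds hs.1 hs.2) hy

end Smooth

lemma exp_neg_le_inv {x y : ℝ} (hx : 0 < x) (h : x ≤ y) : Real.exp (-y) ≤ 1 / x := by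
  rw [Real.exp_neg, ← one_div]
  exact one_div_le_one_div_of_le hx (by linarith [Real.add_one_le_exp y])

/-- One step of the bootstrap: the solution of a second order equation with coefficient at least
`(κ x)²` gains one power of `x`, away from the end points where it need not vanish. -/
lemma decay_of_second_order {a₁ b₁ a' b' κ d x C K : ℝ} {w w' w'' : ℝ → ℂ} {q : ℝ → ℝ} {N : ℕ}
    (hκ : 0 < κ) (hd : 0 < d) (hx : 0 ≤ x) (hK : 0 ≤ K)
    (hw : ContinuousOn w (Icc a₁ b₁))
    (h1 : ∀ t ∈ Ioo a₁ b₁, HasDerivAt w (w' t) t)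
    (h2 : ∀ t ∈ Ioo a₁ b₁, HasDerivAt w' (w'' t) t)
    (hq : ∀ t ∈ Ioo a₁ b₁, (κ * x) ^ 2 ≤ q t)
    (hh : ∀ t ∈ Ioo a₁ b₁, ‖w'' t - q t * w t‖ ≤ K * (1 + x) / (1 + x) ^ N)
    (hC : ∀ t ∈ Icc a₁ b₁, (1 + x) ^ N * ‖w t‖ ≤ C)
    (ha : a₁ + d ≤ a') (hb : b' ≤ b₁) (hb' : b' + d ≤ b₁ ∨ w b₁ = 0) :
    ∀ t ∈ Icc a' b', (1 + x) ^ (N + 1) * ‖w t‖ ≤ 2 * C + 4 * K / κ ^ 2 + 4 * C / (κ * d) := by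
  intro t ht
  have hp : 0 < (1 + x) ^ N := by positivity
  have htt : t ∈ Icc a₁ b₁ := ⟨by linarith [ht.1], ht.2.trans hb⟩
  have hab : a₁ ≤ b₁ := htt.1.trans htt.2
  have hC0 : 0 ≤ C := le_trans (by positivity) (hC t htt)
  rcases le_total x 1 with hx1 | hx1
  · have h3 : (1 + x) ^ (N + 1) * ‖w t‖ ≤ 2 * C := by
      rw [pow_succ, mul_right_comm]
      nlinarith [hC t htt, mul_nonneg hp.le (norm_nonneg (w t))]
    have : 0 ≤ 4 * K / κ ^ 2 + 4 * C / (κ * d) := by positivity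
    linarith
  have hx0 : 0 < x := by linarith
  have hle : ∀ s ∈ Icc a₁ b₁, ‖w s‖ ≤ C / (1 + x) ^ N := fun s hs => by
    rw [le_div_iff₀ hp, mul_comm]; exact hC s hs
  have hCp : 0 ≤ C / (1 + x) ^ N := by positivity
  have hl : 0 < κ * x := by positivity
  have key : ‖w t‖ ≤ K * (1 + x) / (1 + x) ^ N / (κ * x) ^ 2 + C / (1 + x) ^ N * (1 / (κ * x * d))
      + C / (1 + x) ^ N * (1 / (κ * x * d)) := by
    have e1 : Real.exp (-(κ * x * (t - a₁))) ≤ 1 / (κ * x * d) :=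
      exp_neg_le_inv (by positivity) (mul_le_mul_of_nonneg_left (by linarith [ht.1]) hl.le)
    rcases hb' with hb' | hb'
    · have e2 : Real.exp (-(κ * x * (b₁ - t))) ≤ 1 / (κ * x * d) :=
        exp_neg_le_inv (by positivity) (mul_le_mul_of_nonneg_left (by linarith [ht.2]) hl.le)
      refine (norm_le_of_second_order hl (by positivity) hw h1 h2 hq hh
        (hle _ ⟨le_rfl, hab⟩) (hle _ ⟨hab, le_rfl⟩) t htt).trans ?_
      gcongr
    · refine (norm_le_of_second_order hl (by positivity) hw h1 h2 hq hh
        (hle _ ⟨le_rfl, hab⟩) (m := 0) (by simp [hb']) t htt).trans ?_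
      rw [zero_mul]
      gcongr
      positivity
  have hr : (1 + x) / x ≤ 2 := by rw [div_le_iff₀ hx0]; linarith
  have hr0 : 0 ≤ (1 + x) / x := by positivity
  have h4 : (1 + x) ^ (N + 1) * ‖w t‖ ≤
      K / κ ^ 2 * ((1 + x) / x) ^ 2 + 2 * (C / (κ * d)) * ((1 + x) / x) := by
    refine (mul_le_mul_of_nonneg_left key (by positivity)).trans (le_of_eq ?_)
    field_simp
    ring
  have hK' : 0 ≤ K / κ ^ 2 := by positivity
  have hC' : 0 ≤ C / (κ * d) := by positivity
  have h5 : ((1 + x) / x) ^ 2 ≤ 4 := by nlinarith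
  have h6 : 4 * K / κ ^ 2 = K / κ ^ 2 * 4 := by ring
  have h7 : 4 * C / (κ * d) = 2 * (C / (κ * d)) * 2 := by ring
  nlinarith [mul_le_mul_of_nonneg_left h5 hK', mul_le_mul_of_nonneg_left hr hC']

section Equation

variable {E : Type*} [NormedAddCommGroup E] [InnerProductSpace ℝ E] {ι : Type*} [Fintype ι]

/-- A solution `u` of `∂ₜ² u + ∑ⱼ cⱼ(t) ∂ⱼ² u = G` on the strip `[a, b] × B`. -/
structure IsStripSolution (e : OrthonormalBasis ι ℝ E) (a b : ℝ) (B : Set E) (c : ι → ℝ → ℝ)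
    (G u : ℝ × E → ℂ) : Prop where
  lt : a < b
  isOpen : IsOpen B
  coeff_smooth : ∀ j, ContDiff ℝ ∞ (c j)
  elliptic : ∃ c₀ > 0, ∀ j, ∀ t ∈ Icc a b, c₀ ≤ c j t
  smooth_rhs : ContDiffOn ℝ ∞ G (Icc a b ×ˢ B)
  contDiffOn : ContDiffOn ℝ 2 u (Ioo a b ×ˢ B)
  continuousOn : ContinuousOn u (Icc a b ×ˢ B)
  eqn : ∀ x ∈ Ioo a b ×ˢ B, fderiv ℝ (fun z => fderiv ℝ u z (1, 0)) x (1, 0) +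
    ∑ j, (c j x.1 : ℂ) * fderiv ℝ (fun z => fderiv ℝ u z (0, e j)) x (0, e j) = G x

lemma IsStripSolution.contDiffOn_partial {B : Set E} {G u : ℝ × E → ℂ} {a b : ℝ}
    {c : ι → ℝ → ℝ} {e : OrthonormalBasis ι ℝ E} (hu : IsStripSolution e a b B c G u) 
    (η : ℝ × E) :
    ContDiffOn ℝ 1 (fun x => fderiv ℝ u x η) (Ioo a b ×ˢ B) :=
  (hu.contDiffOn.fderiv_of_isOpen (isOpen_Ioo.prod hu.isOpen) (by norm_num)).clm_apply
    contDiffOn_const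

variable [FiniteDimensional ℝ E] [MeasurableSpace E] [BorelSpace E] {B : Set E} {χ h : E → ℂ}
  {f G u : ℝ × E → ℂ} {a b : ℝ} {c : ι → ℝ → ℝ} {e : OrthonormalBasis ι ℝ E}

lemma IsCutoff.expInner_mul_integrable (hχ : IsCutoff B χ) (hB : IsOpen B)
    (hh : ContinuousOn h B) (ξ : E) : Integrable (fun y => expInner y (-ξ) * (χ y * h y)) :=
  (hχ.mul_integrable hB hh).norm.mono' (hχ.aestronglyMeasurable hB hh ξ)
    (Eventually.of_forall fun y => by rw [norm_mul, norm_expInner, one_mul])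

/-- The lower order terms of the equation satisfied by the localised Fourier transform. -/
def lowerOrder (e : OrthonormalBasis ι ℝ E) (c : ι → ℝ → ℝ) (χ : E → ℂ) (G u : ℝ × E → ℂ)
    (t : ℝ) (ξ : E) : ℂ :=
  locFourier χ G t ξ + ∑ j, (c j t : ℂ) *
    (4 * Real.pi * Complex.I * (inner ℝ ξ (e j) : ℝ) *
      locFourier (fun y => fderiv ℝ χ y (e j)) u t ξ
      + (-1) * locFourier (fun y => fderiv ℝ (fun z => fderiv ℝ χ z (e j)) y (e j)) u t ξ)

/-- The symbol of the tangential part of the equation. -/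
def tangentialSymbol (e : OrthonormalBasis ι ℝ E) (c : ι → ℝ → ℝ) (ξ : E) (t : ℝ) : ℝ :=
  ∑ j, c j t * (4 * Real.pi ^ 2 * inner ℝ ξ (e j) ^ 2)

lemma IsCutoff.locFourier_partial (hχ : IsCutoff B χ) (hB : IsOpen B)
    (hf : ContDiffOn ℝ 1 f (Ioo a b ×ˢ B)) {t : ℝ} (ht : t ∈ Ioo a b) (η ξ : E) :
    locFourier χ (fun x => fderiv ℝ f x (0, η)) t ξ =
      2 * Real.pi * Complex.I * (inner ℝ ξ η : ℝ) * locFourier χ f t ξ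
        - locFourier (fun y => fderiv ℝ χ y η) f t ξ := by
  refine hχ.fourier_mul_fderiv hB (hf.slice ht) (fun y hy => ?_) ξ
  rw [fderiv_slice (hf.differentiableOn (by simp) _ ⟨ht, hy⟩) hB ht hy,
    fderivWithin_of_isOpen (isOpen_Ioo.prod hB) ⟨ht, hy⟩]

lemma IsStripSolution.locFourier_eqn (hu : IsStripSolution e a b B c G u) (hχ : IsCutoff B χ)
    {t : ℝ} (ht : t ∈ Ioo a b) (ξ : E) :
    locFourier χ (fun x => fderiv ℝ (fun z => fderiv ℝ u z (1, 0)) x (1, 0)) t ξ =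
      tangentialSymbol e c ξ t * locFourier χ u t ξ + lowerOrder e c χ G u t ξ := by
  have hO : IsOpen (Ioo a b ×ˢ B) := isOpen_Ioo.prod hu.isOpen
  have hc2 (η : ℝ × E) :
      ContinuousOn (fun x => fderiv ℝ (fun z => fderiv ℝ u z η) x η) (Ioo a b ×ˢ B) :=
    ((hu.contDiffOn_partial η).continuousOn_fderiv_of_isOpen hO le_rfl).clm_apply
      continuousOn_const
  have hi (η : ℝ × E) := hχ.expInner_mul_integrable hu.isOpen (continuousOn_slice (hc2 η) ht) ξ
  have h1 : locFourier χ (fun x => fderiv ℝ (fun z => fderiv ℝ u z (1, 0)) x (1, 0)) t ξ +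
      ∑ j, (c j t : ℂ) *
        locFourier χ (fun x => fderiv ℝ (fun z => fderiv ℝ u z (0, e j)) x (0, e j)) t ξ =
      locFourier χ G t ξ := by
    simp only [locFourier_eq, ← integral_const_mul]
    rw [← integral_finsetSum _ fun j _ => (hi (0, e j)).const_mul _,
      ← integral_add (hi (1, 0)) (integrable_finsetSum _ fun j _ => (hi (0, e j)).const_mul _)]
    refine integral_congr_ae (Eventually.of_forall fun y => ?_)
    by_cases hy : y ∈ B
    · simp only [← hu.eqn (t, y) ⟨ht, hy⟩, mul_add, Finset.mul_sum]
      congr 1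
      exact Finset.sum_congr rfl fun j _ => by ring
    · simp [hχ.eq_zero hy]
  have h2 (j : ι) : locFourier χ (fun x => fderiv ℝ (fun z => fderiv ℝ u z (0, e j)) x (0, e j))
      t ξ = -(4 * Real.pi ^ 2 * (inner ℝ ξ (e j) : ℝ) ^ 2 * locFourier χ u t ξ)
        - (4 * Real.pi * Complex.I * (inner ℝ ξ (e j) : ℝ) *
          locFourier (fun y => fderiv ℝ χ y (e j)) u t ξ
        + (-1) * locFourier (fun y => fderiv ℝ (fun z => fderiv ℝ χ z (e j)) y (e j)) u t ξ) := by
    have hu1 : ContDiffOn ℝ 1 u (Ioo a b ×ˢ B) := hu.contDiffOn.of_le (by norm_num)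
    rw [hχ.locFourier_partial hu.isOpen (hu.contDiffOn_partial (0, e j)) ht,
      hχ.locFourier_partial hu.isOpen hu1 ht,
      (hχ.fderiv_apply (e j)).locFourier_partial hu.isOpen hu1 ht]
    linear_combination (4 * Real.pi ^ 2 * (inner ℝ ξ (e j) : ℝ) ^ 2 * locFourier χ u t ξ) *
      Complex.I_sq
  rw [lowerOrder, tangentialSymbol, ← h1]
  simp only [h2]
  push_cast
  rw [Finset.sum_mul, add_left_comm, ← Finset.sum_add_distrib, add_assoc, left_eq_add,
    ← Finset.sum_add_distrib]
  refine Finset.sum_eq_zero fun j _ => ?_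
  ring

lemma IsStripSolution.hasDerivAt (hu : IsStripSolution e a b B c G u) (hχ : IsCutoff B χ)
    {t : ℝ} (ht : t ∈ Ioo a b) (ξ : E) :
    HasDerivAt (fun s => locFourier χ u s ξ)
      (locFourier χ (fun x => fderiv ℝ u x (1, 0)) t ξ) t := by
  have hO : IsOpen (Ioo a b ×ˢ B) := isOpen_Ioo.prod hu.isOpen
  refine hχ.hasDerivAt_locFourier hu.isOpen ht hu.contDiffOn.continuousOn
    (hu.contDiffOn_partial _).continuousOn (fun y hy s hs => ?_) ξ
  have := hasDerivAt_slice (hu.contDiffOn.differentiableOn (by simp) _ ⟨hs, hy⟩)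
    (isOpen_Ioo.mem_nhds hs) hy
  rwa [fderivWithin_of_isOpen hO ⟨hs, hy⟩] at this

lemma IsStripSolution.hasDerivAt_second (hu : IsStripSolution e a b B c G u) (hχ : IsCutoff B χ)
    {t : ℝ} (ht : t ∈ Ioo a b) (ξ : E) :
    HasDerivAt (fun s => locFourier χ (fun x => fderiv ℝ u x (1, 0)) s ξ)
      (tangentialSymbol e c ξ t * locFourier χ u t ξ + lowerOrder e c χ G u t ξ) t := by
  have hO : IsOpen (Ioo a b ×ˢ B) := isOpen_Ioo.prod hu.isOpen
  rw [← hu.locFourier_eqn hχ ht]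
  refine hχ.hasDerivAt_locFourier hu.isOpen ht (hu.contDiffOn_partial _).continuousOn
    (((hu.contDiffOn_partial _).continuousOn_fderiv_of_isOpen hO le_rfl).clm_apply
      continuousOn_const) (fun y hy s hs => ?_) ξ
  have := hasDerivAt_slice ((hu.contDiffOn_partial (1, 0)).differentiableOn (by simp) _ ⟨hs, hy⟩)
    (isOpen_Ioo.mem_nhds hs) hy
  rwa [fderivWithin_of_isOpen hO ⟨hs, hy⟩] at this

end Equation

section Bootstrap

variable {E : Type*} [NormedAddCommGroup E] [InnerProductSpace ℝ E] {ι : Type*} [Fintype ι]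
  {B : Set E} {χ : E → ℂ}
  {G u : ℝ × E → ℂ} {a b a' b' : ℝ} {c : ι → ℝ → ℝ} {e : OrthonormalBasis ι ℝ E}

lemma IsStripSolution.exists_le_tangentialSymbol (hu : IsStripSolution e a b B c G u) :
    ∃ κ > 0, ∀ t ∈ Icc a b, ∀ ξ, (κ * ‖ξ‖) ^ 2 ≤ tangentialSymbol e c ξ t := by
  obtain ⟨c₀, hc₀, hc⟩ := hu.elliptic
  refine ⟨2 * Real.pi * √c₀, by positivity, fun t ht ξ => ?_⟩
  rw [mul_pow, mul_pow, Real.sq_sqrt hc₀.le, ← e.sum_sq_inner_left, tangentialSymbol,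
    Finset.mul_sum]
  refine Finset.sum_le_sum fun j _ => ?_
  have := mul_le_mul_of_nonneg_right (hc j t ht)
    (by positivity : 0 ≤ 4 * Real.pi ^ 2 * inner ℝ ξ (e j) ^ 2)
  rw [real_inner_comm] at this ⊢
  linarith

variable [FiniteDimensional ℝ E] [MeasurableSpace E] [BorelSpace E]

lemma IsStripSolution.locFourier_decay (hu : IsStripSolution e a b B c G u) (ha : a < a')
    (hb : b' < b ∨ b' = b ∧ ∀ y ∈ B, u (b, y) = 0) (N : ℕ) (hχ : IsCutoff B χ) :
    ∃ C : ℝ, ∀ t ∈ Icc a' b', ∀ ξ, (1 + ‖ξ‖) ^ N * ‖locFourier χ u t ξ‖ ≤ C := by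
  induction N generalizing χ a' b' with
  | zero =>
    obtain ⟨C, hC⟩ := hχ.locFourier_bounded isCompact_Icc hu.continuousOn
    have hb' : b' ≤ b := hb.elim le_of_lt fun h => h.1.le
    exact ⟨C, fun t ht ξ => by simpa using hC t ⟨ha.le.trans ht.1, ht.2.trans hb'⟩ ξ⟩
  | succ N ih =>
    obtain ⟨b₁, hb₁, hb'₁, d, hd, hd', had, hz⟩ : ∃ b₁,
        (b₁ < b ∨ b₁ = b ∧ ∀ y ∈ B, u (b, y) = 0) ∧ b' ≤ b₁ ∧ ∃ d > 0, a < a' - d ∧ a' - d < a' ∧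
          (b' + d ≤ b₁ ∨ b₁ = b ∧ ∀ y ∈ B, u (b, y) = 0) := by
      rcases hb with hb | ⟨hb, hz⟩
      · refine ⟨(b' + b) / 2, .inl (by linarith), by linarith,
          min ((a' - a) / 2) ((b - b') / 2), lt_min (by linarith) (by linarith), ?_, ?_, .inl ?_⟩
        · linarith [min_le_left ((a' - a) / 2) ((b - b') / 2)]
        · linarith [lt_min (a := 0) (b := (a' - a) / 2) (c := (b - b') / 2) (by linarith)
            (by linarith)]
        · linarith [min_le_right ((a' - a) / 2) ((b - b') / 2)]
      · exact ⟨b, .inr ⟨rfl, hz⟩, hb.le, (a' - a) / 2, by linarith, by linarith, by linarith,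
          .inr ⟨rfl, hz⟩⟩
    have hb₁b : b₁ ≤ b := hb₁.elim le_of_lt fun h => h.1.le
    have hsub : Icc (a' - d) b₁ ⊆ Icc a b := Icc_subset_Icc hd'.le hb₁b
    have hsubo : Ioo (a' - d) b₁ ⊆ Ioo a b := Ioo_subset_Ioo hd'.le hb₁b
    obtain ⟨κ, hκ, hq⟩ := hu.exists_le_tangentialSymbol
    obtain ⟨C, hC⟩ := ih hd' hb₁ hχ
    obtain ⟨CG, hCG⟩ := hχ.locFourier_decay hu.lt hu.isOpen hu.smooth_rhs N
    choose A hA using fun j => (isCompact_Icc (a := a) (b := b)).exists_bound_of_continuousOn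
      (hu.coeff_smooth j).continuous.continuousOn
    choose C₁ hC₁ using fun j => ih hd' hb₁ (hχ.fderiv_apply (e j))
    choose C₂ hC₂ using fun j => ih hd' hb₁ ((hχ.fderiv_apply (e j)).fderiv_apply (e j))
    set K : ℝ := |CG| + ∑ j, |A j| * (4 * Real.pi * |C₁ j| + |C₂ j|) with hK
    have hK0 : 0 ≤ K := by positivity
    refine ⟨_, fun t ht ξ => decay_of_second_order (x := ‖ξ‖) (C := C) (K := K)
      (w := fun t => locFourier χ u t ξ)
      (q := tangentialSymbol e c ξ) hκ hd (norm_nonneg ξ) hK0 ?_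
      (fun s hs => hu.hasDerivAt hχ (hsubo hs) ξ)
      (fun s hs => hu.hasDerivAt_second hχ (hsubo hs) ξ)
      (fun s hs => hq s (Ioo_subset_Icc_self (hsubo hs)) ξ) (fun s hs => ?_)
      (fun s hs => hC s hs ξ) (by linarith) hb'₁ ?_ t ht⟩
    · exact (hχ.locFourier_continuousOn hu.isOpen isCompact_Icc hu.continuousOn).comp
        (f := fun s : ℝ => (s, ξ)) (by fun_prop) fun s hs => ⟨hsub hs, mem_univ _⟩
    · have hs' := Ioo_subset_Icc_self hs
      have hp : 0 < (1 + ‖ξ‖) ^ N := by positivity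
      rw [add_sub_cancel_left, le_div_iff₀ hp, mul_comm, lowerOrder]
      have hx := norm_nonneg ξ
      calc (1 + ‖ξ‖) ^ N * ‖_‖ ≤ (1 + ‖ξ‖) ^ N * (‖locFourier χ G s ξ‖ + ∑ j, ‖c j s‖ *
            (4 * Real.pi * ‖ξ‖ * ‖locFourier (fun y => fderiv ℝ χ y (e j)) u s ξ‖ +
              ‖locFourier (fun y => fderiv ℝ (fun z => fderiv ℝ χ z (e j)) y (e j)) u s ξ‖)) := by
            refine mul_le_mul_of_nonneg_left ((norm_add_le _ _).trans (add_le_add le_rfl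
              ((norm_sum_le _ _).trans (Finset.sum_le_sum fun j _ => ?_)))) hp.le
            rw [norm_mul, Complex.norm_real]
            refine mul_le_mul_of_nonneg_left ((norm_add_le _ _).trans ?_) (norm_nonneg _)
            have hin : |inner ℝ ξ (e j)| ≤ ‖ξ‖ := by
              simpa [e.norm_eq_one] using abs_real_inner_le_norm ξ (e j)
            simp only [norm_mul, Complex.norm_I, Complex.norm_real, Real.norm_eq_abs,
              Complex.norm_ofNat, mul_one, abs_of_pos Real.pi_pos, norm_neg, norm_one, one_mul]
            gcongr
        _ = (1 + ‖ξ‖) ^ N * ‖locFourier χ G s ξ‖ + ∑ j, ‖c j s‖ * (4 * Real.pi * ‖ξ‖ *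
              ((1 + ‖ξ‖) ^ N * ‖locFourier (fun y => fderiv ℝ χ y (e j)) u s ξ‖) + (1 + ‖ξ‖) ^ N *
              ‖locFourier (fun y => fderiv ℝ (fun z => fderiv ℝ χ z (e j)) y (e j)) u s ξ‖) := by
            rw [mul_add, Finset.mul_sum]
            congr 1
            exact Finset.sum_congr rfl fun j _ => by ring
        _ ≤ |CG| + ∑ j, |A j| * (4 * Real.pi * ‖ξ‖ * |C₁ j| + |C₂ j|) := by
            refine add_le_add ((hCG s (hsub hs') ξ).trans (le_abs_self _))
              (Finset.sum_le_sum fun j _ => mul_le_mul ((hA j s (hsub hs')).trans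
                (le_abs_self _)) (add_le_add (mul_le_mul_of_nonneg_left
                ((hC₁ j s hs' ξ).trans (le_abs_self _)) (by positivity))
                ((hC₂ j s hs' ξ).trans (le_abs_self _))) (by positivity) (by positivity))
        _ ≤ K * (1 + ‖ξ‖) := by
            rw [hK, add_mul, Finset.sum_mul]
            have hCG0 : |CG| ≤ |CG| * (1 + ‖ξ‖) :=
              le_mul_of_one_le_right (abs_nonneg _) (by linarith)
            refine add_le_add hCG0 (Finset.sum_le_sum fun j _ => ?_)
            rw [mul_assoc |A j|]
            refine mul_le_mul_of_nonneg_left ?_ (abs_nonneg _)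
            have h5 : 0 ≤ 4 * Real.pi * |C₁ j| := by positivity
            have h6 : 0 ≤ |C₂ j| * ‖ξ‖ := by positivity
            linarith
    · refine hz.imp_right fun ⟨h1, h2⟩ => ?_
      have h3 (y : E) : χ y * u (b, y) = 0 := by
        by_cases hy : y ∈ B
        · rw [h2 y hy, mul_zero]
        · rw [hχ.eq_zero hy, zero_mul]
      simp [locFourier_eq, h1, h3]

lemma IsStripSolution.rapidDecayDeriv (hu : IsStripSolution e a b B c G u) (ha : a < a')
    (hab : a' < b') (hb : b' < b ∨ b' = b ∧ ∀ y ∈ B, u (b, y) = 0) (n : ℕ) (hχ : IsCutoff B χ) :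
    RapidDecayDeriv a' b' n (locFourier χ u) := by
  have hb' : b' ≤ b := hb.elim le_of_lt fun h => h.1.le
  have hsub : Icc a' b' ⊆ Icc a b := Icc_subset_Icc ha.le hb'
  have hsubo : Ioo a' b' ⊆ Ioo a b := Ioo_subset_Ioo ha.le hb'
  induction n generalizing χ with
  | zero =>
    exact ⟨(hχ.locFourier_continuousOn hu.isOpen isCompact_Icc hu.continuousOn).mono
      (prod_mono_left hsub), fun N => hu.locFourier_decay ha hb N hχ⟩
  | succ n ih =>
    refine RapidDecayDeriv.of_succ ((ih hχ).rapidDecay.of_second_deriv hab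
      (w₂ := fun t ξ => tangentialSymbol e c ξ t * locFourier χ u t ξ + lowerOrder e c χ G u t ξ)
      ?_ fun ξ => ⟨_, fun t ht => hu.hasDerivAt hχ (hsubo ht) ξ,
        fun t ht => hu.hasDerivAt_second hχ (hsubo ht) ξ⟩)
    have hc (j : ι) : ContDiff ℝ ∞ (fun t => (c j t : ℂ)) :=
      Complex.ofRealCLM.contDiff.comp (hu.coeff_smooth j)
    refine RapidDecayDeriv.add ?_ (RapidDecayDeriv.add ?_ ?_)
    · have := RapidDecayDeriv.sum Finset.univ fun j _ => (ih hχ).mul (hc j)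
        (((polyGrowth_inner (e j)).mul (polyGrowth_inner (e j))).mul
          (polyGrowth_const (4 * Real.pi ^ 2)))
      convert! this using 3
      rw [tangentialSymbol]
      push_cast
      rw [Finset.sum_mul]
      exact Finset.sum_congr rfl fun j _ => by ring
    · exact hχ.rapidDecayDeriv_locFourier hab hu.isOpen
        (hu.smooth_rhs.mono (prod_mono_left hsub)) n
    · have := RapidDecayDeriv.sum Finset.univ fun j _ =>
        (((ih (hχ.fderiv_apply (e j))).mul_poly ((polyGrowth_const (4 * Real.pi * Complex.I)).mul
          (polyGrowth_inner (e j)))).add ((ih ((hχ.fderiv_apply (e j)).fderiv_apply (e j))).mul_poly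
          (polyGrowth_const (-1)))).mul (hc j) (polyGrowth_const 1)
      convert! this using 3
      exact Finset.sum_congr rfl fun j _ => by ring

/-- Solutions are smooth in the interior and, if they vanish at `t = b`, up to `t = b`. -/
theorem IsStripSolution.contDiffOn_cutoff (hu : IsStripSolution e a b B c G u) (ha : a < a')
    (hab : a' < b') (hb : b' < b ∨ b' = b ∧ ∀ y ∈ B, u (b, y) = 0) (hχ : IsCutoff B χ) :
    ContDiffOn ℝ ∞ (fun x : ℝ × E => χ x.2 * u x) (Icc a' b' ×ˢ univ) := by
  have hb' : b' ≤ b := hb.elim le_of_lt fun h => h.1.le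
  refine contDiffOn_infty.2 fun n => ?_
  refine ((hu.rapidDecayDeriv ha hab hb n hχ).contDiffOn_integral hab).congr fun x hx => ?_
  have hc := hχ.mul_continuous hu.isOpen
    (continuousOn_slice hu.continuousOn ⟨ha.le.trans hx.1.1, hx.1.2.trans hb'⟩)
  have hr := (hu.rapidDecayDeriv ha hab hb 0 hχ).rapidDecay
  obtain ⟨g, hg, hgb⟩ := hr.exists_integrable_bound
  have hF : Integrable (𝓕 (fun y => χ y * u (x.1, y))) := by
    refine hg.mono' (hr.continuous_apply hx.1).aestronglyMeasurable
      (Eventually.of_forall fun ξ => le_trans ?_ (hgb x.1 hx.1 ξ))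
    exact le_mul_of_one_le_left (norm_nonneg _) (by linarith [norm_nonneg ξ])
  have := congrFun (hc.fourierInv_fourier_eq
    (hc.integrable_of_hasCompactSupport (hχ.mul_hasCompactSupport _)) hF) x.2
  rw [Real.fourierInv_eq'] at this
  rw [← this]
  simp [expInner, locFourier]

theorem IsStripSolution.contDiffOn_nhds (hu : IsStripSolution e a b B c G u) (ha : a < a')
    (hab : a' < b') (hb : b' < b ∨ b' = b ∧ ∀ y ∈ B, u (b, y) = 0) {y : E} (hy : y ∈ B) :
    ∃ U ∈ 𝓝 y, ContDiffOn ℝ ∞ u (Icc a' b' ×ˢ U) := by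
  obtain ⟨ψ, hψ, hψc, hψs, -, hψ1⟩ := exists_contDiff_tsupport_subset (n := ⊤)
    (hu.isOpen.mem_nhds hy)
  have hχ : IsCutoff B (fun y => (ψ y : ℂ)) := by
    refine ⟨Complex.ofRealCLM.contDiff.comp hψs, hψc.comp_left (g := ((↑) : ℝ → ℂ)) (by simp), ?_⟩
    refine (closure_mono fun z hz => ?_).trans hψ
    simpa using hz
  have h1 := hu.contDiffOn_cutoff ha hab hb hχ
  have hcont : Continuous ψ := hψs.continuous
  refine ⟨{z | ψ z ≠ 0}, (isOpen_ne_fun hcont continuous_const).mem_nhds (by simp [hψ1]), ?_⟩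
  have h2 : ContDiffOn ℝ ∞ (fun x : ℝ × E => (ψ x.2 : ℂ)⁻¹) (Icc a' b' ×ˢ {z | ψ z ≠ 0}) :=
    ((hχ.smooth.comp contDiff_snd).contDiffOn).inv fun x hx => by simpa using hx.2
  refine (h2.mul (h1.mono (prod_mono_right (subset_univ _)))).congr fun x hx => ?_
  have : (ψ x.2 : ℂ) ≠ 0 := by simpa using hx.2
  field_simp

end Bootstrap

section Chart

/-- `ℝ³`, the space of tangential variables. -/
abbrev TangentialSpace : Type := EuclideanSpace ℝ (Fin 3)

/-- The map `(t, y) ↦ t + i y₀`. -/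
def logCoord : ℝ × TangentialSpace →L[ℝ] ℂ :=
  Complex.ofRealCLM.comp (ContinuousLinearMap.fst ℝ ℝ TangentialSpace) +
    (Complex.I • Complex.ofRealCLM).comp
      ((EuclideanSpace.proj (0 : Fin 3) : TangentialSpace →L[ℝ] ℝ).comp
        (ContinuousLinearMap.snd ℝ ℝ TangentialSpace))

/-- The map `(t, y) ↦ y₁ + i y₂`. -/
def affineCoord : ℝ × TangentialSpace →L[ℝ] ℂ :=
  Complex.ofRealCLM.comp ((EuclideanSpace.proj (1 : Fin 3) : TangentialSpace →L[ℝ] ℝ).comp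
      (ContinuousLinearMap.snd ℝ ℝ TangentialSpace)) +
    (Complex.I • Complex.ofRealCLM).comp
      ((EuclideanSpace.proj (2 : Fin 3) : TangentialSpace →L[ℝ] ℝ).comp
        (ContinuousLinearMap.snd ℝ ℝ TangentialSpace))

@[simp] lemma logCoord_apply (x : ℝ × TangentialSpace) :
    logCoord x = x.1 + Complex.I * x.2 0 := by
  simp [logCoord]

@[simp] lemma affineCoord_apply (x : ℝ × TangentialSpace) :
    affineCoord x = x.2 1 + Complex.I * x.2 2 := by
  simp [affineCoord]

/-- The factor `z₁ - α` in logarithmic coordinates. -/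
def polarFactor (β : ℂ) (x : ℝ × TangentialSpace) : ℂ := β * Complex.exp (logCoord x)

/-- Logarithmic coordinates around `α` in the first factor, affine ones in the second. -/
def polarChart (α β p₂ : ℂ) (x : ℝ × TangentialSpace) : ℂ × ℂ :=
  (α + polarFactor β x, p₂ + affineCoord x)

/-- The differential of `polarChart`. -/
def polarChartDeriv (β : ℂ) (x : ℝ × TangentialSpace) : ℝ × TangentialSpace →L[ℝ] ℂ × ℂ :=
  (polarFactor β x • logCoord).prod affineCoord

lemma contDiff_polarFactor (β : ℂ) {n : WithTop ℕ∞} : ContDiff ℝ n (polarFactor β) :=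
  contDiff_const.mul logCoord.contDiff.cexp

lemma contDiff_polarChart (α β p₂ : ℂ) {n : WithTop ℕ∞} : ContDiff ℝ n (polarChart α β p₂) :=
  (contDiff_const.add (contDiff_polarFactor β)).prodMk (contDiff_const.add affineCoord.contDiff)

lemma hasFDerivAt_polarFactor (β : ℂ) (x : ℝ × TangentialSpace) :
    HasFDerivAt (polarFactor β) (polarFactor β x • logCoord) x := by
  refine ((logCoord.hasFDerivAt (x := x)).cexp.const_mul β).congr_fderiv ?_
  rw [smul_smul, polarFactor]

lemma hasFDerivAt_polarChart (α β p₂ : ℂ) (x : ℝ × TangentialSpace) :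
    HasFDerivAt (polarChart α β p₂) (polarChartDeriv β x) x :=
  ((hasFDerivAt_polarFactor β x).const_add α).prodMk
    ((affineCoord.hasFDerivAt (x := x)).const_add p₂)

lemma norm_polarFactor {β : ℂ} (hβ : ‖β‖ = 1) (x : ℝ × TangentialSpace) :
    ‖polarFactor β x‖ = Real.exp x.1 := by
  simp [polarFactor, hβ, Complex.norm_exp]

variable {v : ℂ × ℂ → ℂ} {O : Set (ℂ × ℂ)} {α β p₂ : ℂ} {x : ℝ × TangentialSpace}

lemma fderiv_comp_polarChart (hv : DifferentiableAt ℝ v (polarChart α β p₂ x))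
    (η : ℝ × TangentialSpace) : fderiv ℝ (v ∘ polarChart α β p₂) x η =
      fderiv ℝ v (polarChart α β p₂ x) (polarChartDeriv β x η) := by
  rw [(hv.hasFDerivAt.comp x (hasFDerivAt_polarChart α β p₂ x)).fderiv]
  rfl

lemma fderiv_fderiv_comp_polarChart (hO : IsOpen O) (hv : ContDiffOn ℝ 2 v O)
    (hx : polarChart α β p₂ x ∈ O) (η : ℝ × TangentialSpace) :
    fderiv ℝ (fun z => fderiv ℝ (v ∘ polarChart α β p₂) z η) x η =
      fderiv ℝ (fderiv ℝ v) (polarChart α β p₂ x) (polarChartDeriv β x η) (polarChartDeriv β x η)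
        + fderiv ℝ v (polarChart α β p₂ x) (polarFactor β x * logCoord η ^ 2, 0) := by
  have hev : (fun z => fderiv ℝ (v ∘ polarChart α β p₂) z η) =ᶠ[𝓝 x]
      fun z => fderiv ℝ v (polarChart α β p₂ z) (polarChartDeriv β z η) := by
    filter_upwards [(contDiff_polarChart α β p₂ (n := 0)).continuous.continuousAt.preimage_mem_nhds
      (hO.mem_nhds hx)] with z hz
    exact fderiv_comp_polarChart
      ((hv.contDiffAt (hO.mem_nhds hz)).differentiableAt (by simp)) η
  rw [hev.fderiv_eq]
  have h1 : HasFDerivAt (fderiv ℝ v) _ (polarChart α β p₂ x) :=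
    (((hv.fderiv_of_isOpen hO (m := 1) (by norm_num)).contDiffAt
      (hO.mem_nhds hx)).differentiableAt (by simp)).hasFDerivAt
  have h2 := h1.comp x (hasFDerivAt_polarChart α β p₂ x)
  have h3 : HasFDerivAt (fun z => polarChartDeriv β z η)
      (((polarFactor β x * logCoord η) • logCoord).prod 0) x := by
    have := ((hasFDerivAt_polarFactor β x).mul_const (logCoord η)).prodMk
      (hasFDerivAt_const (affineCoord η) x)
    refine this.congr_fderiv ?_
    ext z <;> simp <;> ring
  have h4 := (h2.clm_apply h3).fderiv
  simp only [Function.comp_def] at h4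
  rw [h4]
  simp [add_comm, pow_two, mul_assoc]

end Chart

section BiDisc

variable {v g : ℂ × ℂ → ℂ} {O : Set (ℂ × ℂ)} {α β p₂ : ℂ} {x : ℝ × TangentialSpace}

lemma biDisc_eq : biDisc = Metric.ball 0 1 ×ˢ Metric.ball 0 1 := by
  ext z; simp [biDisc]

lemma isOpen_biDisc : IsOpen biDisc := by
  rw [biDisc_eq]; exact Metric.isOpen_ball.prod Metric.isOpen_ball

lemma mem_closure_biDisc {z : ℂ × ℂ} : z ∈ closure biDisc ↔ ‖z.1‖ ≤ 1 ∧ ‖z.2‖ ≤ 1 := by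
  rw [biDisc_eq, closure_prod_eq, closure_ball 0 one_ne_zero]
  simp

lemma lap_eq (hO : IsOpen O) (hv : ContDiffOn ℝ 2 v O) {z : ℂ × ℂ} (hz : z ∈ O) :
    lap v z = fderiv ℝ (fderiv ℝ v) z (1, 0) (1, 0)
      + fderiv ℝ (fderiv ℝ v) z (Complex.I, 0) (Complex.I, 0)
      + fderiv ℝ (fderiv ℝ v) z (0, 1) (0, 1)
      + fderiv ℝ (fderiv ℝ v) z (0, Complex.I) (0, Complex.I) := by
  have h1 : DifferentiableAt ℝ (fderiv ℝ v) z :=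
    ((hv.fderiv_of_isOpen hO (m := 1) (by norm_num)).contDiffAt
      (hO.mem_nhds hz)).differentiableAt (by simp)
  have h2 (d : ℂ × ℂ) : fderiv ℝ (fun w => fderiv ℝ v w d) z d =
      fderiv ℝ (fderiv ℝ v) z d d := by
    rw [fderiv_clm_apply h1 (differentiableAt_const d)]
    simp
  simp only [lap, h2]

/-- A symmetric bilinear form on `ℂ × ℂ`, summed over the rotated pair `ζ, iζ`. -/
lemma symm_bilin_add_rotate (Q : ℂ × ℂ →L[ℝ] ℂ × ℂ →L[ℝ] ℂ) (hQ : ∀ d e, Q d e = Q e d) (ζ : ℂ) :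
    Q (ζ, 0) (ζ, 0) + Q (ζ * Complex.I, 0) (ζ * Complex.I, 0) =
      (‖ζ‖ ^ 2 : ℝ) * (Q (1, 0) (1, 0) + Q (Complex.I, 0) (Complex.I, 0)) := by
  have h1 : ((ζ, 0) : ℂ × ℂ) = ζ.re • (1, 0) + ζ.im • (Complex.I, 0) := by
    apply Prod.ext <;> simp
  have h2 : ((ζ * Complex.I, 0) : ℂ × ℂ) = (-ζ.im) • (1, 0) + ζ.re • (Complex.I, 0) := by
    refine Prod.ext (Complex.ext ?_ ?_) ?_ <;> simp
  rw [h1, h2, ← Complex.normSq_eq_norm_sq, Complex.normSq_apply]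
  simp only [map_add, map_smul, add_apply, smul_apply,
    hQ (Complex.I, 0) (1, 0), Complex.real_smul]
  push_cast
  ring

/-- The coefficients of the Laplacian in the coordinates `polarChart`, multiplied by `exp (2 * t)`. -/
def chartCoeff (j : Fin 3) (t : ℝ) : ℝ := if j = 0 then 1 else Real.exp (2 * t)

lemma lap_polarChart (hO : IsOpen O) (hv : ContDiffOn ℝ 2 v O) (hβ : ‖β‖ = 1)
    (hx : polarChart α β p₂ x ∈ O) :
    fderiv ℝ (fun z => fderiv ℝ (v ∘ polarChart α β p₂) z (1, 0)) x (1, 0) +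
      ∑ j, (chartCoeff j x.1 : ℂ) * fderiv ℝ (fun z => fderiv ℝ (v ∘ polarChart α β p₂) z
        (0, EuclideanSpace.basisFun (Fin 3) ℝ j)) x (0, EuclideanSpace.basisFun (Fin 3) ℝ j) =
      (Real.exp (2 * x.1) : ℝ) * lap v (polarChart α β p₂ x) := by
  have hsymm : IsSymmSndFDerivAt ℝ v (polarChart α β p₂ x) :=
    (hv.contDiffAt (hO.mem_nhds hx)).isSymmSndFDerivAt (by simp)
  have hrot := symm_bilin_add_rotate _ (fun d e => hsymm d e) (polarFactor β x)
  have hexp : ‖polarFactor β x‖ ^ 2 = Real.exp (2 * x.1) := by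
    rw [norm_polarFactor hβ, ← Real.exp_nat_mul]; norm_num
  rw [hexp] at hrot
  simp only [fderiv_fderiv_comp_polarChart hO hv hx, lap_eq hO hv hx, Fin.sum_univ_three,
    chartCoeff]
  simp [polarChartDeriv]
  have hneg : ((-polarFactor β x, 0) : ℂ × ℂ) = -(polarFactor β x, 0) := by simp
  rw [hneg, map_neg, Prod.mk_zero_zero, map_zero]
  push_cast at hrot
  linear_combination hrot

lemma isStripSolution_polarChart {a b : ℝ} {B : Set TangentialSpace}
    (hg : ContDiffOn ℝ ∞ g (closure biDisc)) (hv₂ : ContDiffOn ℝ 2 v biDisc)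
    (hvcont : ContinuousOn v (closure biDisc)) (hPDE : ∀ z ∈ biDisc, lap v z = g z)
    (hβ : ‖β‖ = 1) (hab : a < b) (hB : IsOpen B)
    (ho : MapsTo (polarChart α β p₂) (Ioo a b ×ˢ B) biDisc)
    (hc : MapsTo (polarChart α β p₂) (Icc a b ×ˢ B) (closure biDisc)) :
    IsStripSolution (EuclideanSpace.basisFun (Fin 3) ℝ) a b B chartCoeff
      (fun x => (Real.exp (2 * x.1) : ℝ) * g (polarChart α β p₂ x)) (v ∘ polarChart α β p₂) where
  lt := hab
  isOpen := hB
  coeff_smooth j := by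
    unfold chartCoeff
    split_ifs <;> fun_prop
  elliptic := by
    refine ⟨min 1 (Real.exp (2 * a)), lt_min one_pos (Real.exp_pos _), fun j t ht => ?_⟩
    unfold chartCoeff
    split_ifs
    · exact min_le_left _ _
    · exact (min_le_right _ _).trans (Real.exp_le_exp.2 (by linarith [ht.1]))
  smooth_rhs := by
    refine ContDiffOn.mul ?_ (hg.comp (contDiff_polarChart α β p₂).contDiffOn hc)
    exact (Complex.ofRealCLM.contDiff.comp
      (Real.contDiff_exp.comp (contDiff_const.mul contDiff_fst))).contDiffOn
  contDiffOn := hv₂.comp (contDiff_polarChart α β p₂).contDiffOn ho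
  continuousOn :=
    hvcont.comp (contDiff_polarChart α β p₂ (n := 0)).continuous.continuousOn hc
  eqn x hx := by rw [lap_polarChart isOpen_biDisc hv₂ hβ (ho hx), hPDE _ (ho hx)]

/-- A local inverse of `polarChart`. -/
def polarChartSymm (α β p₂ : ℂ) (z : ℂ × ℂ) : ℝ × TangentialSpace :=
  ((Complex.log ((z.1 - α) / β)).re,
    !₂[(Complex.log ((z.1 - α) / β)).im, (z.2 - p₂).re, (z.2 - p₂).im])

lemma polarChart_polarChartSymm {z : ℂ × ℂ} (hβ : β ≠ 0) (hz : z.1 ≠ α) :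
    polarChart α β p₂ (polarChartSymm α β p₂ z) = z := by
  have h1 : (z.1 - α) / β ≠ 0 := div_ne_zero (sub_ne_zero.2 hz) hβ
  apply Prod.ext
  · simp only [polarChart, polarFactor, logCoord_apply, polarChartSymm]
    have h2 : (((Complex.log ((z.1 - α) / β)).re : ℂ) + Complex.I *
        ((Complex.log ((z.1 - α) / β)).im : ℂ)) = Complex.log ((z.1 - α) / β) := by
      rw [mul_comm]; exact Complex.re_add_im _
    simp only [Matrix.cons_val_zero]
    rw [h2, Complex.exp_log h1]
    field_simp
    ring
  · simp only [polarChart, affineCoord_apply, polarChartSymm, Matrix.cons_val]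
    rw [mul_comm, Complex.re_add_im]
    ring

lemma polarChartSymm_self (hβ : β ≠ 0) : polarChartSymm α β p₂ (α + β, p₂) = 0 := by
  have h : ((α + β, p₂) : ℂ × ℂ).1 - α = β := by simp
  apply Prod.ext
  · simp [polarChartSymm, hβ]
  · ext j
    fin_cases j <;> simp [polarChartSymm, hβ]

lemma contDiffAt_polarChartSymm (hβ : β ≠ 0) {n : WithTop ℕ∞} :
    ContDiffAt ℝ n (polarChartSymm α β p₂) (α + β, p₂) := by
  have hl : ContDiffAt ℝ n (fun z : ℂ × ℂ => Complex.log ((z.1 - α) / β)) (α + β, p₂) := by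
    refine ContDiffAt.comp (g := Complex.log) (f := fun z : ℂ × ℂ => (z.1 - α) / β) _ ?_ ?_
    · refine (Complex.contDiffAt_log ?_).restrict_scalars ℝ
      simp [hβ]
    · exact ((contDiff_fst.sub contDiff_const).div_const β).contDiffAt
  have hs : ContDiff ℝ n (fun z : ℂ × ℂ => z.2 - p₂) := contDiff_snd.sub contDiff_const
  refine (Complex.reCLM.contDiff.contDiffAt.comp _ hl).prodMk (contDiffAt_euclidean.2 fun j => ?_)
  fin_cases j
  · exact Complex.imCLM.contDiff.contDiffAt.comp _ hl
  · exact (Complex.reCLM.contDiff.comp hs).contDiffAt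
  · exact (Complex.imCLM.contDiff.comp hs).contDiffAt

lemma contDiffWithinAt_of_polarChart {a b a' b' : ℝ} {B : Set TangentialSpace}
    (hg : ContDiffOn ℝ ∞ g (closure biDisc)) (hv₂ : ContDiffOn ℝ 2 v biDisc)
    (hvcont : ContinuousOn v (closure biDisc)) (hPDE : ∀ z ∈ biDisc, lap v z = g z)
    (hβ : ‖β‖ = 1) (hab : a < b) (hB : IsOpen B) (h0 : 0 ∈ B)
    (ho : MapsTo (polarChart α β p₂) (Ioo a b ×ˢ B) biDisc)
    (hc : MapsTo (polarChart α β p₂) (Icc a b ×ˢ B) (closure biDisc))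
    (ha : a < a') (hab' : a' < b')
    (hb : b' < b ∨ b' = b ∧ ∀ y ∈ B, v (polarChart α β p₂ (b, y)) = 0)
    (hp : (α + β, p₂) ∈ closure biDisc) (h0' : 0 ∈ Icc a' b')
    (hm : ∀ᶠ z in 𝓝[closure biDisc] (α + β, p₂), (polarChartSymm α β p₂ z).1 ∈ Icc a' b') :
    ContDiffWithinAt ℝ ∞ v (closure biDisc) (α + β, p₂) := by
  have hβ0 : β ≠ 0 := norm_ne_zero_iff.1 (by rw [hβ]; exact one_ne_zero)
  obtain ⟨U, hU, hs⟩ := (isStripSolution_polarChart hg hv₂ hvcont hPDE hβ hab hB ho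
    hc).contDiffOn_nhds ha hab' hb h0
  have hψ : ContDiffAt ℝ ∞ (polarChartSymm α β p₂) (α + β, p₂) := contDiffAt_polarChartSymm hβ0
  have hself : polarChartSymm α β p₂ (α + β, p₂) = 0 := polarChartSymm_self hβ0
  have hne : ∀ᶠ z in 𝓝[closure biDisc] (α + β, p₂), z.1 ≠ α := by
    refine mem_nhdsWithin_of_mem_nhds ((isOpen_ne_fun continuous_fst continuous_const).mem_nhds ?_)
    simpa using hβ0
  have hcomp := ContDiffWithinAt.comp_of_preimage_mem_nhdsWithin (α + β, p₂)
    (g := v ∘ polarChart α β p₂) (f := polarChartSymm α β p₂) (s := closure biDisc)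
    (by rw [hself]; exact hs 0 ⟨h0', mem_of_mem_nhds hU⟩) hψ.contDiffWithinAt (by
      have hsnd : Tendsto (fun z => (polarChartSymm α β p₂ z).2)
          (𝓝[closure biDisc] (α + β, p₂)) (𝓝 0) := by
        have := (continuous_snd.continuousAt.comp hψ.continuousAt).tendsto
        simp only [Function.comp_def, hself] at this
        exact this.mono_left nhdsWithin_le_nhds
      filter_upwards [hm, hsnd hU] with z h1 h2 using ⟨h1, h2⟩)
  refine hcomp.congr_of_eventuallyEq_of_mem ?_ hp
  filter_upwards [hne] with z hz
  simp only [Function.comp_def, polarChart_polarChartSymm hβ0 hz]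

end BiDisc

section Local

variable {v g : ℂ × ℂ → ℂ} {p : ℂ × ℂ}

lemma tendsto_polarChartSymm_fst {α β p₂ : ℂ} (hβ : β ≠ 0) :
    Tendsto (fun z => (polarChartSymm α β p₂ z).1) (𝓝 (α + β, p₂)) (𝓝 0) := by
  have := (continuous_fst.continuousAt.comp
    (contDiffAt_polarChartSymm (p₂ := p₂) (α := α) hβ (n := 0)).continuousAt).tendsto
  simpa only [Function.comp_def, polarChartSymm_self hβ, Prod.fst_zero] using this

lemma contDiffWithinAt_boundary (hg : ContDiffOn ℝ ∞ g (closure biDisc))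
    (hv₂ : ContDiffOn ℝ 2 v biDisc) (hvcont : ContinuousOn v (closure biDisc))
    (hPDE : ∀ z ∈ biDisc, lap v z = g z) (hbd : ∀ z ∈ frontier biDisc, v z = 0)
    (h1 : ‖p.1‖ = 1) (h2 : ‖p.2‖ < 1) : ContDiffWithinAt ℝ ∞ v (closure biDisc) p := by
  have hp0 : p.1 ≠ 0 := norm_ne_zero_iff.1 (by rw [h1]; exact one_ne_zero)
  have hp : (0 + p.1, p.2) = p := by rw [zero_add]
  have hnorm (x : ℝ × TangentialSpace) : ‖(polarChart 0 p.1 p.2 x).1‖ = Real.exp x.1 := by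
    simp only [polarChart, zero_add, norm_polarFactor h1]
  have hsnd (x : ℝ × TangentialSpace) :
      (polarChart 0 p.1 p.2 x).2 = p.2 + (x.2 1 + Complex.I * x.2 2) := by
    simp only [polarChart, affineCoord_apply]
  rw [← hp]
  refine contDiffWithinAt_of_polarChart (a := -1) (b := 0) (a' := -1 / 2) (b' := 0)
    (B := {y | ‖p.2 + (y 1 + Complex.I * y 2)‖ < 1}) hg hv₂ hvcont hPDE h1 (by norm_num)
    (isOpen_lt (by fun_prop) continuous_const) (by simpa using h2) (fun x hx => ⟨?_, ?_⟩)
    (fun x hx => mem_closure_biDisc.2 ⟨?_, ?_⟩) (by norm_num) (by norm_num)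
    (.inr ⟨rfl, fun y hy => hbd _ ?_⟩) ?_ ⟨by norm_num, le_rfl⟩ ?_
  · rw [hnorm]; exact Real.exp_zero ▸ Real.exp_lt_exp.2 hx.1.2
  · rw [hsnd]; exact hx.2
  · rw [hnorm]; exact Real.exp_le_one_iff.2 hx.1.2
  · rw [hsnd]; exact le_of_lt hx.2
  · rw [isOpen_biDisc.frontier_eq, Set.mem_sdiff, mem_closure_biDisc, hnorm, hsnd]
    refine ⟨⟨by simp, le_of_lt hy⟩, fun h => ?_⟩
    have := h.1
    rw [hnorm, Real.exp_zero] at this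
    exact lt_irrefl _ this
  · rw [hp]; exact mem_closure_biDisc.2 ⟨h1.le, h2.le⟩
  · have ht := (tendsto_polarChartSymm_fst (α := 0) (p₂ := p.2) hp0).mono_left
      (nhdsWithin_le_nhds (s := closure biDisc))
    filter_upwards [self_mem_nhdsWithin, ht (Ici_mem_nhds (by norm_num : (-1 / 2 : ℝ) < 0))]
      with z hz hz'
    refine ⟨hz', ?_⟩
    simp only [polarChartSymm, Complex.log_re, sub_zero, norm_div, h1, div_one]
    exact Real.log_nonpos (norm_nonneg _) (mem_closure_biDisc.1 hz).1

lemma contDiffWithinAt_interior (hg : ContDiffOn ℝ ∞ g (closure biDisc))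
    (hv₂ : ContDiffOn ℝ 2 v biDisc) (hvcont : ContinuousOn v (closure biDisc))
    (hPDE : ∀ z ∈ biDisc, lap v z = g z) (hp : p ∈ biDisc) :
    ContDiffWithinAt ℝ ∞ v (closure biDisc) p := by
  have hp' : (p.1 - 1 + 1, p.2) = p := by rw [sub_add_cancel]
  have hW : polarChart (p.1 - 1) 1 p.2 ⁻¹' biDisc ∈ 𝓝 ((0 : ℝ), (0 : TangentialSpace)) := by
    refine (contDiff_polarChart _ _ _ (n := 0)).continuous.continuousAt.preimage_mem_nhds
      (isOpen_biDisc.mem_nhds ?_)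
    simpa [polarChart, polarFactor] using hp
  obtain ⟨S, hS, B', hB', hSB⟩ := mem_nhds_prod_iff.1 hW
  obtain ⟨δ, hδ, hδS⟩ := Metric.nhds_basis_closedBall.mem_iff.1 hS
  rw [Real.closedBall_eq_Icc, zero_sub, zero_add] at hδS
  obtain ⟨B, hBB', hB, h0⟩ := mem_nhds_iff.1 hB'
  have hmap : MapsTo (polarChart (p.1 - 1) 1 p.2) (Icc (-δ) δ ×ˢ B) biDisc :=
    fun x hx => hSB ⟨hδS hx.1, hBB' hx.2⟩
  have hmem : (0 : ℝ) ∈ Ioo (-δ / 2) (δ / 2) := ⟨by linarith, by linarith⟩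
  rw [← hp']
  refine contDiffWithinAt_of_polarChart (a := -δ) (b := δ) (a' := -δ / 2) (b' := δ / 2)
    (B := B) hg hv₂ hvcont hPDE norm_one (by linarith) hB h0
    (hmap.mono_left (prod_mono_left Ioo_subset_Icc_self)) (hmap.mono_right subset_closure)
    (by linarith) (by linarith) (.inl (by linarith)) ?_ (Ioo_subset_Icc_self hmem) ?_
  · rw [hp']; exact subset_closure hp
  · exact (tendsto_polarChartSymm_fst one_ne_zero).mono_left nhdsWithin_le_nhds
      (Icc_mem_nhds hmem.1 hmem.2)

lemma lap_comp_swap (v : ℂ × ℂ → ℂ) (z : ℂ × ℂ) : lap (v ∘ Prod.swap) z = lap v z.swap := by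
  have h (f : ℂ × ℂ → ℂ) (w d : ℂ × ℂ) :
      fderiv ℝ (f ∘ Prod.swap) w d = fderiv ℝ f w.swap d.swap := by
    have := (ContinuousLinearEquiv.prodComm ℝ ℂ ℂ).comp_right_fderiv (f := f) (x := w)
    exact congrArg (fun L : ℂ × ℂ →L[ℝ] ℂ => L d) this
  have h2 (d : ℂ × ℂ) : fderiv ℝ (fun w => fderiv ℝ (v ∘ Prod.swap) w d) z d =
      fderiv ℝ (fun w => fderiv ℝ v w d.swap) z.swap d.swap := by
    have : (fun w => fderiv ℝ (v ∘ Prod.swap) w d) = (fun w => fderiv ℝ v w d.swap) ∘ Prod.swap :=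
      funext fun w => h v w d
    rw [this, h]
  simp only [lap, h2, Prod.swap_prod_mk]
  ring

lemma swap_mem_biDisc {z : ℂ × ℂ} : z.swap ∈ biDisc ↔ z ∈ biDisc := and_comm

lemma swap_mem_closure_biDisc {z : ℂ × ℂ} : z.swap ∈ closure biDisc ↔ z ∈ closure biDisc := by
  simp only [mem_closure_biDisc, Prod.fst_swap, Prod.snd_swap, and_comm]

lemma contDiffWithinAt_of_notMem_distBoundary (hg : ContDiffOn ℝ ∞ g (closure biDisc))
    (hv₂ : ContDiffOn ℝ 2 v biDisc) (hvcont : ContinuousOn v (closure biDisc))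
    (hPDE : ∀ z ∈ biDisc, lap v z = g z) (hbd : ∀ z ∈ frontier biDisc, v z = 0)
    (hp : p ∈ closure biDisc) (hp' : p ∉ distBoundary) :
    ContDiffWithinAt ℝ ∞ v (closure biDisc) p := by
  obtain ⟨h1, h2⟩ := mem_closure_biDisc.1 hp
  rcases h2.lt_or_eq with h2 | h2
  · rcases h1.lt_or_eq with h1 | h1
    · exact contDiffWithinAt_interior hg hv₂ hvcont hPDE ⟨h1, h2⟩
    · exact contDiffWithinAt_boundary hg hv₂ hvcont hPDE hbd h1 h2
  have h1 : ‖p.1‖ < 1 := h1.lt_of_ne fun h => hp' ⟨h, h2⟩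
  have hs {n : WithTop ℕ∞} : ContDiff ℝ n (Prod.swap : ℂ × ℂ → ℂ × ℂ) :=
    contDiff_snd.prodMk contDiff_fst
  have hmo : MapsTo Prod.swap biDisc biDisc := fun z hz => swap_mem_biDisc.2 hz
  have hmc : MapsTo Prod.swap (closure biDisc) (closure biDisc) :=
    fun z hz => swap_mem_closure_biDisc.2 hz
  have key : ContDiffWithinAt ℝ ∞ (v ∘ Prod.swap) (closure biDisc) p.swap := by
    refine contDiffWithinAt_boundary (g := g ∘ Prod.swap) (hg.comp hs.contDiffOn hmc)
      (hv₂.comp hs.contDiffOn hmo) (hvcont.comp continuous_swap.continuousOn hmc)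
      (fun z hz => ?_) (fun z hz => hbd _ ?_) h2 h1
    · rw [lap_comp_swap, hPDE _ (hmo hz), Function.comp_apply]
    · rw [isOpen_biDisc.frontier_eq] at hz ⊢
      exact ⟨hmc hz.1, fun h => hz.2 (swap_mem_biDisc.1 h)⟩
  have := key.comp p hs.contDiffWithinAt hmc
  simpa only [Function.comp_def, Prod.swap_swap] using this

end Local

theorem dirichlet_smooth_away_from_distinguished_boundary
    (g v : ℂ × ℂ → ℂ)
    (hg : ContDiffOn ℝ (⊤ : ℕ∞) g (closure biDisc))
    (hv₂ : ContDiffOn ℝ 2 v biDisc)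
    (hvcont : ContinuousOn v (closure biDisc))
    (hPDE : ∀ z ∈ biDisc, lap v z = g z)
    (hbd : ∀ z ∈ frontier biDisc, v z = 0) :
    ∀ V : Set (ℂ × ℂ), IsOpen V → V ∩ distBoundary = ∅ →
      ContDiffOn ℝ (⊤ : ℕ∞) v (V ∩ closure biDisc) := by
  intro V _ hVd p hp
  refine (contDiffWithinAt_of_notMem_distBoundary hg hv₂ hvcont hPDE hbd hp.2 fun h => ?_).mono
    inter_subset_right
  exact (hVd ▸ ⟨hp.1, h⟩ : p ∈ (∅ : Set (ℂ × ℂ)))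
end
end
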